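/- arXiv:1711.01706 — 5 statements merged into one kernel-verified Lean document; each statement's English description precedes it below -/
import Mathlib

section
/- Let p be a prime with p ≡ 1 (mod 3), and let L, M be integers with 4p = L² + 27M². Then every prime q dividing the product L·M is a cubic residue modulo p. -/
namespace CubicAux

lemma uniq (p : ℕ) (hp : p.Prime) (L M L' M' : ℤ)
    (h : 4 * (p : ℤ) = L ^ 2 + 27 * M ^ 2) (h' : 4 * (p : ℤ) = L' ^ 2 + 27 * M' ^ 2) :
    M' ^ 2 = M ^ 2 ∧ L' ^ 2 = L ^ 2 := by
  have hpp : Prime (p : ℤ) := Nat.prime_iff_prime_int.mp hp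
  have hp0 : (p : ℤ) ≠ 0 := hpp.ne_zero
  have key : ∀ N : ℤ, 4 * (p : ℤ) = L' ^ 2 + 27 * N ^ 2 → (p : ℤ) ∣ L * N - L' * M →
      N ^ 2 = M ^ 2 := by
    intro N hN ⟨v, hv⟩
    have e : 16 * (p : ℤ) ^ 2 = (L * L' + 27 * M * N) ^ 2 + 27 * (L * N - L' * M) ^ 2 := by
      linear_combination (4 * (p : ℤ)) * h + (L ^ 2 + 27 * M ^ 2) * hN
    have hd : (p : ℤ) ∣ (L * L' + 27 * M * N) ^ 2 := by
      refine ⟨16 * p - 27 * p * v ^ 2, ?_⟩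
      rw [hv] at e
      linear_combination -e
    obtain ⟨u, hu⟩ := hpp.dvd_of_dvd_pow hd
    rw [hu, hv] at e
    have e2 : (16 : ℤ) = u ^ 2 + 27 * v ^ 2 := by
      have : (p : ℤ) ^ 2 * 16 = (p : ℤ) ^ 2 * (u ^ 2 + 27 * v ^ 2) := by linear_combination e
      exact mul_left_cancel₀ (pow_ne_zero 2 hp0) this
    have v0 : v = 0 := by
      have : v ^ 2 < 1 := by nlinarith [sq_nonneg u]
      nlinarith [sq_nonneg v, pow_eq_zero_iff (two_ne_zero) (a := v), this,
        (pow_eq_zero_iff (two_ne_zero) (a := v)).mp (by nlinarith [sq_nonneg v])]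
    subst v0
    have : 4 * (p : ℤ) * N ^ 2 = 4 * (p : ℤ) * M ^ 2 := by
      linear_combination (L * N + L' * M) * hv + N ^ 2 * h - M ^ 2 * hN
    exact mul_left_cancel₀ (by simpa using hp0) this
  have hM : M' ^ 2 = M ^ 2 := by
    have : (p : ℤ) ∣ (L * M' - L' * M) * (L * M' + L' * M) := by
      refine ⟨4 * (M' ^ 2 - M ^ 2), ?_⟩
      linear_combination -M' ^ 2 * h + M ^ 2 * h'
    rcases hpp.dvd_or_dvd this with h1 | h1
    · exact key M' h' h1
    · have := key (-M') (by rw [h']; ring) (by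
        have : L * -M' - L' * M = -(L * M' + L' * M) := by ring
        rw [this]; exact (dvd_neg).mpr h1)
      simpa using this
  exact ⟨hM, by linarith⟩

lemma cyc {K : Type*} [Field K] (F : K →+* K) (x y z : K) (hx : F x = y) (hy : F y = z)
    (hz : F z = x)
    (h : (x - y) * (y - z) * (z - x) = 0 ∨
      ((3 : K) ≠ 0 ∧ (3 * x + 1) * (3 * y + 1) * (3 * z + 1) = 0)) : x = y ∧ y = z := by
  rcases h with h | ⟨h3, h⟩
  · have hi := F.injective
    rcases mul_eq_zero.mp h with h | h
    · rcases mul_eq_zero.mp h with h | h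
      · have : x = y := sub_eq_zero.mp h
        refine ⟨this, ?_⟩
        grind
      · have : y = z := sub_eq_zero.mp h
        refine ⟨?_, this⟩
        grind
    · have : z = x := sub_eq_zero.mp h
      grind
  · have s : ∀ u v, F u = v → 3 * u + 1 = 0 → 3 * v + 1 = 0 := by
      intro u v huv hu
      have := congrArg F hu
      rw [map_add, map_mul, map_ofNat, map_one, map_zero, huv] at this
      exact this
    have all : 3 * x + 1 = 0 ∧ 3 * y + 1 = 0 ∧ 3 * z + 1 = 0 := by
      rcases mul_eq_zero.mp h with h | h
      · rcases mul_eq_zero.mp h with h | h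
        · exact ⟨h, s _ _ hx h, s _ _ hy (s _ _ hx h)⟩
        · exact ⟨s _ _ hz (s _ _ hy h), h, s _ _ hy h⟩
      · exact ⟨s _ _ hz h, s _ _ hx (s _ _ hz h), h⟩
    obtain ⟨a, b, c⟩ := all
    exact ⟨mul_left_cancel₀ h3 (by linear_combination a - b),
      mul_left_cancel₀ h3 (by linear_combination b - c)⟩

lemma cube_of_char {p : ℕ} [Fact p.Prime] {R : Type*} [CommRing R] [IsDomain R]
    (χ : MulChar (ZMod p) R) (hχ : orderOf χ = 3) (a : ZMod p) (ha : χ a = 1) :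
    ∃ x : ZMod p, x ^ 3 = a := by
  have ha0 : a ≠ 0 := by
    rintro rfl
    rw [χ.map_zero] at ha
    exact zero_ne_one ha
  obtain ⟨g, hg⟩ := IsCyclic.exists_generator (α := (ZMod p)ˣ)
  obtain ⟨k, hk⟩ := (mem_powers_iff_mem_zpowers.mpr (hg (Units.mk0 a ha0)))
  have hk' : (g : ZMod p) ^ k = a := by
    have := congrArg Units.val hk
    simpa using this
  have h3 : χ (g : ZMod p) ^ 3 = 1 := by
    rw [← χ.pow_apply_coe, ← hχ, pow_orderOf_eq_one]; simp
  have h1 : χ (g : ZMod p) ≠ 1 := by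
    intro h
    have : χ = 1 := by
      ext u
      obtain ⟨m, hm⟩ := (mem_powers_iff_mem_zpowers.mpr (hg u))
      simp only at hm
      rw [← hm]; simp [h]
    rw [this] at hχ; simp at hχ
  have ho : orderOf (χ (g : ZMod p)) = 3 := orderOf_eq_prime h3 h1
  have : 3 ∣ k := by
    rw [← ho]; apply orderOf_dvd_of_pow_eq_one
    rw [← map_pow, hk', ha]
  obtain ⟨m, rfl⟩ := this
  exact ⟨(g : ZMod p) ^ m, by rw [← hk', ← pow_mul, mul_comm]⟩

lemma sum_repr {R ι : Type*} [CommRing R] (ω : R) (hω : ω ^ 2 + ω + 1 = 0) (s : Finset ι) (t : ι → R)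
    (ht : ∀ i ∈ s, t i = 0 ∨ t i = 1 ∨ t i = ω ∨ t i = ω ^ 2) :
    ∃ a b : ℤ, ∑ i ∈ s, t i = a + b * ω ∧ ∑ i ∈ s, t i ^ 2 = a + b * ω ^ 2 := by
  classical
  induction s using Finset.induction_on with
  | empty => exact ⟨0, 0, by simp, by simp⟩
  | insert i s hi ih =>
    obtain ⟨a, b, h1, h2⟩ := ih (fun j hj => ht j (Finset.mem_insert_of_mem hj))
    rw [Finset.sum_insert hi, Finset.sum_insert hi, h1, h2]
    rcases ht i (Finset.mem_insert_self i s) with h | h | h | h <;> rw [h]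
    · exact ⟨a, b, by ring, by ring⟩
    · exact ⟨a + 1, b, by push_cast; ring, by push_cast; ring⟩
    · exact ⟨a, b + 1, by push_cast; ring, by push_cast; ring⟩
    · exact ⟨a - 1, b - 1, by push_cast; linear_combination hω,
        by push_cast; linear_combination (ω ^ 2 - ω + 1) * hω⟩

lemma indep {R : Type*} [CommRing R] [IsDomain R] [CharZero R] (ω : R)
    (hω : ω ^ 2 + ω + 1 = 0) (a b : ℤ) (h : (a : R) + b * ω = 0) : a = 0 ∧ b = 0 := by
  have : ((a ^ 2 - a * b + b ^ 2 : ℤ) : R) = 0 := by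
    push_cast
    linear_combination (a + b * (-1 - ω)) * h + (b : R) ^ 2 * hω
  have h0 : a ^ 2 - a * b + b ^ 2 = 0 := by exact_mod_cast this
  have hb : b = 0 := by
    have : b ^ 2 = 0 := by nlinarith [sq_nonneg (2 * a - b), sq_nonneg b]
    exact pow_eq_zero_iff (two_ne_zero) |>.mp this
  subst hb
  exact ⟨by simpa using h0, rfl⟩

lemma mem_adj {R : Type*} [CommRing R] (ω : R) (hω : ω ^ 2 + ω + 1 = 0) (z : R)
    (hz : z ∈ Algebra.adjoin ℤ {ω}) : ∃ c d : ℤ, z = c + d * ω := by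
  induction hz using Algebra.adjoin_induction with
  | mem x hx => exact ⟨0, 1, by simp at hx; simp [hx]⟩
  | algebraMap r => exact ⟨r, 0, by simp⟩
  | add x y _ _ hx hy =>
    obtain ⟨a, b, rfl⟩ := hx
    obtain ⟨c, d, rfl⟩ := hy
    exact ⟨a + c, b + d, by push_cast; ring⟩
  | mul x y _ _ hx hy =>
    obtain ⟨a, b, rfl⟩ := hx
    obtain ⟨c, d, rfl⟩ := hy
    exact ⟨a * c - b * d, a * d + b * c - b * d, by push_cast; linear_combination (b * d : R) * hω⟩

lemma exists_ring (p q : ℕ) (hp : p.Prime) (hq : q.Prime) :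
    ∃ (R : Type) (_ : CommRing R) (_ : IsDomain R) (_ : CharZero R) (K : Type) (_ : Field K)
      (_ : CharP K q) (_ : R →+* K) (ω ζ : R), IsPrimitiveRoot ω 3 ∧ IsPrimitiveRoot ζ p := by
  have hint : ∀ n : ℕ, n ≠ 0 → ∃ ζ : integralClosure ℤ ℂ, IsPrimitiveRoot ζ n := by
    intro n hn
    have h := Complex.isPrimitiveRoot_exp n hn
    refine ⟨⟨_, h.isIntegral (Nat.pos_of_ne_zero hn)⟩, ?_⟩
    exact IsPrimitiveRoot.of_map_of_injective (f := (integralClosure ℤ ℂ).val)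
      (by exact h) Subtype.val_injective
  obtain ⟨ω, hω⟩ := hint 3 (by norm_num)
  obtain ⟨ζ, hζ⟩ := hint p hp.ne_zero
  have hnu : ¬ IsUnit ((q : ℕ) : integralClosure ℤ ℂ) := by
    intro hu
    obtain ⟨v, hv⟩ := hu.exists_right_inv
    have hv' : (q : ℂ) * (v : ℂ) = 1 := by
      have := congrArg (Subtype.val) hv
      simpa using this
    have hq0 : (q : ℂ) ≠ 0 := by exact_mod_cast hq.ne_zero
    have hvi : IsIntegral ℤ (v : ℂ) := v.2
    have hve : (v : ℂ) = algebraMap ℚ ℂ ((q : ℚ)⁻¹) := by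
      simp; exact eq_inv_of_mul_eq_one_right hv'
    rw [hve] at hvi
    have := (isIntegral_algebraMap_iff (algebraMap ℚ ℂ).injective).mp hvi
    obtain ⟨n, hn⟩ := IsIntegrallyClosed.isIntegral_iff.mp this
    have hqq : (q : ℚ) ≠ 0 := by exact_mod_cast hq.ne_zero
    have : (q : ℤ) * n = 1 := by
      have : (q : ℚ) * (n : ℚ) = 1 := by
        simp at hn; rw [hn]; field_simp
      exact_mod_cast this
    have h1 : (q : ℤ) ∣ 1 := ⟨n, this.symm⟩
    have := Int.natCast_dvd_natCast.mp (by simpa using h1 : (q : ℤ) ∣ ((1 : ℕ) : ℤ))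
    exact hq.one_lt.ne' (Nat.dvd_one.mp this)
  obtain ⟨m, hm, hqm⟩ := exists_max_ideal_of_mem_nonunits hnu
  let _ : Field (integralClosure ℤ ℂ ⧸ m) := Ideal.Quotient.field m
  have : Fact q.Prime := ⟨hq⟩
  have hc : CharP (integralClosure ℤ ℂ ⧸ m) q := by
    have h0 : ((q : ℕ) : integralClosure ℤ ℂ ⧸ m) = 0 := by
      rw [← map_natCast (Ideal.Quotient.mk m)]
      exact Ideal.Quotient.eq_zero_iff_mem.mpr hqm
    exact (CharP.charP_iff_prime_eq_zero hq).mpr h0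
  exact ⟨integralClosure ℤ ℂ, inferInstance, inferInstance, inferInstance, _, _, hc,
    Ideal.Quotient.mk m, ω, ζ, hω, hζ⟩


open Classical in
/-- Gaussian period. -/
noncomputable def eta {p : ℕ} [Fact p.Prime] {R : Type*} [CommRing R]
    (χ : MulChar (ZMod p) R) (ψ : AddChar (ZMod p) R) (c : R) : R :=
  ∑ x, if χ x = c then ψ x else 0

lemma eta_frob {p q : ℕ} [Fact p.Prime] [Fact q.Prime] {R K : Type*} [CommRing R] [Field K]
    [CharP K q] (φ : R →+* K)
    (χ : MulChar (ZMod p) R) (ψ : AddChar (ZMod p) R) (c : R) (hq : (q : ZMod p) ≠ 0) :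
    frobenius K q (φ (eta χ ψ c)) = φ (eta χ ψ (χ q * c)) := by
  classical
  unfold eta
  rw [map_sum, map_sum, map_sum]
  refine Fintype.sum_bijective (fun x : ZMod p => (q : ZMod p) * x)
    (mulLeft_bijective₀ _ hq) _ _ ?_
  intro x
  have hu : IsUnit (χ (q : ZMod p)) := (isUnit_iff_ne_zero.mpr hq).map χ
  have e : χ ((q : ZMod p) * x) = χ q * c ↔ χ x = c := by
    rw [map_mul, hu.mul_right_inj]
  simp only [e]
  split_ifs
  · rw [frobenius_def, ← map_pow, ← nsmul_eq_mul, AddChar.map_nsmul_eq_pow]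
  · simp

theorem core {p q : ℕ} [Fact p.Prime] [Fact q.Prime] (hp3 : p % 3 = 1) {R K : Type*} [CommRing R]
    [IsDomain R] [CharZero R] [Field K] [CharP K q] (φ : R →+* K) (ω ζ : R)
    (hω : IsPrimitiveRoot ω 3) (hζ : IsPrimitiveRoot ζ p) (L M : ℤ)
    (hLM : 4 * (p : ℤ) = L ^ 2 + 27 * M ^ 2) (hdvd : (q : ℤ) ∣ L * M) (hqp : q ≠ p) :
    ∃ x : ZMod p, x ^ 3 = q := by
  classical
  have hpP : p.Prime := Fact.out
  have hqP : q.Prime := Fact.out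
  have h3 : ω ^ 3 = 1 := hω.pow_eq_one
  have hw1 : ω ≠ 1 := hω.ne_one (by norm_num)
  have hw : ω ^ 2 + ω + 1 = 0 := by
    have : (ω - 1) * (ω ^ 2 + ω + 1) = 0 := by linear_combination h3
    exact (mul_eq_zero.mp this).resolve_left (sub_ne_zero.mpr hw1)
  have hw0 : ω ≠ 0 := hω.ne_zero (by norm_num)
  have hw21 : ω ^ 2 ≠ 1 := fun h => hw1 (by linear_combination h3 - ω * h)
  have hw2w : ω ^ 2 ≠ ω := fun h => hw1 (mul_left_cancel₀ hw0 (by linear_combination h))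
  have hqz : (q : ZMod p) ≠ 0 := by
    intro h
    rw [ZMod.natCast_eq_zero_iff] at h
    exact hqp ((Nat.prime_dvd_prime_iff_eq hpP hqP).mp h).symm
  have hpK : (p : K) ≠ 0 := by
    intro h
    rw [CharP.cast_eq_zero_iff K q] at h
    exact hqp ((Nat.prime_dvd_prime_iff_eq hqP hpP).mp h)
  have hpR : (p : R) ≠ 0 := by exact_mod_cast hpP.ne_zero
  have hcard : 3 ∣ Fintype.card (ZMod p) - 1 := by rw [ZMod.card]; omega
  obtain ⟨χ, hχ⟩ := MulChar.exists_mulChar_orderOf (ZMod p) hcard hω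
  have hχ3 : χ ^ 3 = 1 := hχ ▸ pow_orderOf_eq_one χ
  have hχ1 : χ ≠ 1 := by rintro rfl; simp at hχ
  have hχ2 : χ ^ 2 ≠ 1 := by
    intro h
    apply hχ1
    calc χ = χ ^ 3 := by rw [pow_succ, h, one_mul]
      _ = 1 := hχ3
  have hχ4 : χ ^ 2 * χ ^ 2 = χ := by
    rw [← pow_add, pow_succ, hχ3, one_mul]
  by_contra hcon
  have hχq : χ q ≠ 1 := fun h => hcon (cube_of_char χ hχ _ h)
  set ψ := AddChar.zmodChar p ((IsPrimitiveRoot.iff_def ζ p).mp hζ).left with hψdef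
  have hψ : ψ.IsPrimitive := AddChar.zmodChar_primitive_of_primitive_root p hζ
  have hψ1 : ψ ≠ 1 := by
    have := hψ (a := 1) one_ne_zero
    simpa using this
  have hval0 : ∀ x : ZMod p, x ≠ 0 → χ x = 1 ∨ χ x = ω ∨ χ x = ω ^ 2 := by
    intro x hx
    obtain ⟨k, hk, h⟩ := MulChar.exists_apply_eq_pow hχ3 hω hx
    interval_cases k
    · left; simpa using h
    · right; left; simpa using h
    · right; right; exact h
  -- periods
  set x := eta χ ψ 1 with hx
  set y := eta χ ψ ω with hy
  set z := eta χ ψ (ω ^ 2) with hz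
  set g := gaussSum χ ψ with hg
  set g' := gaussSum (χ ^ 2) ψ with hg'
  have n1 := hw1.symm
  have n2 := hw21.symm
  have n3 := hw2w.symm
  have n4 := hw0.symm
  have n5 : ω ^ 2 ≠ 0 := pow_ne_zero 2 hw0
  have n6 := n5.symm
  have gx : g = x + ω * y + ω ^ 2 * z := by
    rw [hg, hx, hy, hz, gaussSum, eta, eta, eta, Finset.mul_sum, Finset.mul_sum,
      ← Finset.sum_add_distrib, ← Finset.sum_add_distrib]
    refine Finset.sum_congr rfl fun t _ => ?_
    by_cases ht : t = 0
    · subst ht; simp [MulChar.map_zero, n4, n6]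
    · rcases hval0 t ht with h | h | h <;> simp [h, *]
  have gx' : g' = x + ω ^ 2 * y + ω * z := by
    rw [hg', hx, hy, hz, gaussSum, eta, eta, eta, Finset.mul_sum, Finset.mul_sum,
      ← Finset.sum_add_distrib, ← Finset.sum_add_distrib]
    refine Finset.sum_congr rfl fun t _ => ?_
    rw [MulChar.pow_apply' χ two_ne_zero]
    by_cases ht : t = 0
    · subst ht; simp [MulChar.map_zero, n4, n6]
    · rcases hval0 t ht with h | h | h <;> simp only [h, if_true, if_false, n1, n2, n3, hw1, hw21,
        hw2w]
      · ring
      · ring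
      · linear_combination (ω * ψ t) * h3
  have hsum : x + y + z = -1 := by
    have h0 : ∑ t, ψ t = 0 := AddChar.sum_eq_zero_of_ne_one hψ1
    have h1 : ∑ t, ψ t = (∑ t : ZMod p, if t = 0 then (1 : R) else 0) + x + y + z := by
      rw [hx, hy, hz, eta, eta, eta,
        ← Finset.sum_add_distrib, ← Finset.sum_add_distrib, ← Finset.sum_add_distrib]
      refine Finset.sum_congr rfl fun t _ => ?_
      by_cases ht : t = 0
      · subst ht; simp [MulChar.map_zero, n4, n6]
      · rcases hval0 t ht with h | h | h <;> simp only [h, ht, if_true, if_false, n1, n2, n3, hw1,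
          hw21, hw2w] <;> ring
    rw [h0] at h1
    simp only [Finset.sum_ite_eq', Finset.mem_univ, if_true] at h1
    linear_combination -h1
  -- Gauss and Jacobi sums
  have hm1 : χ (-1) = 1 := by
    have : χ ((-1) ^ 3) = χ (-1) ^ 3 := map_pow χ _ _
    rw [Odd.neg_one_pow (by decide)] at this
    rw [this, ← MulChar.pow_apply' χ three_ne_zero, hχ3]
    exact MulChar.one_apply (isUnit_one.neg)
  have gg : g * g' = p := by
    have := gaussSum_mul_gaussSum_pow_orderOf_sub_one hχ1 hψ
    rw [hχ, hm1, one_mul, ZMod.card] at this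
    exact this
  set J := jacobiSum χ χ with hJ
  set J' := jacobiSum (χ ^ 2) (χ ^ 2) with hJ'
  have gJ : g' * J = g * g := by
    have := jacobiSum_mul_nontrivial (χ := χ) (φ := χ) (by rwa [← sq]) ψ
    rwa [← sq] at this
  have gJ' : g * J' = g' * g' := by
    have := jacobiSum_mul_nontrivial (χ := χ ^ 2) (φ := χ ^ 2) (by rwa [hχ4]) ψ
    rwa [hχ4] at this
  have g3 : g ^ 3 = p * J := by linear_combination -g * gJ + J * gg
  have g3' : g' ^ 3 = p * J' := by linear_combination -g' * gJ' + J' * gg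
  have JJ : J * J' = p := by
    have : (p : R) * (J * J') = p * p := by
      rw [← gg]; linear_combination g * J' * gJ + g * g * gJ'
    exact mul_left_cancel₀ hpR this
  obtain ⟨a, b, hab, hab'⟩ := sum_repr ω hw Finset.univ (fun t : ZMod p => χ t * χ (1 - t)) (by
    intro t _
    by_cases ht : t = 0
    · left; subst ht; simp [MulChar.map_zero]
    by_cases ht1 : 1 - t = 0
    · left; rw [ht1]; simp [MulChar.map_zero]
    right
    rw [← map_mul]
    exact hval0 _ (mul_ne_zero ht ht1))
  have Jab : J = a + b * ω := by rw [hJ, jacobiSum]; exact hab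
  have Jab' : J' = a + b * ω ^ 2 := by
    rw [hJ', jacobiSum, ← hab']
    refine Finset.sum_congr rfl fun t _ => ?_
    rw [MulChar.pow_apply' χ two_ne_zero, MulChar.pow_apply' χ two_ne_zero, mul_pow]
  have hnorm : a ^ 2 - a * b + b ^ 2 = p := by
    have : ((a ^ 2 - a * b + b ^ 2 : ℤ) : R) = ((p : ℤ) : R) := by
      push_cast
      rw [← JJ, Jab, Jab']
      linear_combination (-(a : R) * b) * hw - (b : R) ^ 2 * h3
    exact_mod_cast this
  obtain ⟨B, hB⟩ : ∃ B, b = 3 * B := by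
    obtain ⟨w, hwm, hwe⟩ := exists_jacobiSum_eq_neg_one_add (by norm_num) hχ3 hχ3 hcard hω
    obtain ⟨c, d, rfl⟩ := mem_adj ω hw w hwm
    have := indep ω hw (a + 1 - 3 * d) (b + 3 * c - 3 * d) (by
      push_cast
      have e : (a : R) + b * ω = -1 + (c + d * ω) * (ω - 1) ^ 2 := by rw [← Jab]; exact hwe
      linear_combination e + (c + d * (ω - 3)) * hw)
    exact ⟨d - c, by linarith [this.2]⟩
  subst hB
  have hrep : 4 * (p : ℤ) = (2 * a - 3 * B) ^ 2 + 27 * B ^ 2 := by rw [← hnorm]; ring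
  obtain ⟨hBM, hAL⟩ := uniq p hpP L M _ _ hLM hrep
  have hqq : Prime (q : ℤ) := Nat.prime_iff_prime_int.mp hqP
  -- product identities
  have idL : (p : R) * ((2 * a - 3 * B : ℤ) : R) = (3 * x + 1) * (3 * y + 1) * (3 * z + 1) := by
    have e1 : g + g' = 3 * x + 1 := by
      rw [gx, gx']; linear_combination (y + z) * hw - hsum
    have e2 : g + ω * g' = ω ^ 2 * (3 * z + 1) := by
      rw [gx, gx']; linear_combination (x + y) * hw + y * h3 - ω ^ 2 * hsum
    have e3 : g + ω ^ 2 * g' = ω * (3 * y + 1) := by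
      rw [gx, gx']; linear_combination (x + z) * hw + (ω * y + z) * h3 - ω * hsum
    have e4 : g ^ 3 + g' ^ 3 = (g + g') * (g + ω * g') * (g + ω ^ 2 * g') := by
      linear_combination (-g ^ 2 * g' - ω * g * g' ^ 2) * hw + (-g * g' ^ 2 * 0 - g' ^ 3) * h3
    rw [e1, e2, e3, g3, g3', Jab, Jab'] at e4
    push_cast at e4 ⊢
    linear_combination e4 - 3 * p * B * hw + (3 * x + 1) * (3 * y + 1) * (3 * z + 1) * h3
  have idM : (p : R) * (B : R) = -((x - y) * (y - z) * (z - x)) := by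
    have e1 : g - g' = (ω - ω ^ 2) * (y - z) := by
      rw [gx, gx']; ring
    have e2 : g - ω * g' = (1 - ω) * (x - y) := by
      rw [gx, gx']; linear_combination (-y) * h3
    have e3 : g - ω ^ 2 * g' = (1 - ω ^ 2) * (x - z) := by
      rw [gx, gx']; linear_combination (-ω * y - z) * h3
    have e4 : g ^ 3 - g' ^ 3 = (g - g') * (g - ω * g') * (g - ω ^ 2 * g') := by
      linear_combination (g ^ 2 * g' - ω * g * g' ^ 2) * hw + g' ^ 3 * h3
    rw [e1, e2, e3, g3, g3', Jab, Jab'] at e4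
    have hne : (3 : R) * (ω - ω ^ 2) ≠ 0 :=
      mul_ne_zero (by norm_num) (sub_ne_zero.mpr n3)
    apply mul_left_cancel₀ hne
    push_cast at e4
    have e5 : (1 - ω) * (1 - ω ^ 2) = 3 := by linear_combination (-1 : R) * hw + h3
    linear_combination e4 + (ω - ω ^ 2) * (y - z) * (x - y) * (x - z) * e5
  -- in `K`
  set F := frobenius K q
  have hgK : φ g ≠ 0 := by
    intro h
    have := congrArg φ gg
    rw [map_mul, h, zero_mul, map_natCast] at this
    exact hpK this.symm
  have hcast : ∀ n : ℤ, (q : ℤ) ∣ n → (n : K) = 0 := fun n hn =>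
    (CharP.intCast_eq_zero_iff K q n).mpr hn
  have hprod : (φ x - φ y) * (φ y - φ z) * (φ z - φ x) = 0 ∨
      ((3 : K) ≠ 0 ∧ (3 * φ x + 1) * (3 * φ y + 1) * (3 * φ z + 1) = 0) := by
    rcases hqq.dvd_or_dvd hdvd with h | h
    · right
      constructor
      · intro h3K
        have : ((3 : ℕ) : K) = 0 := by exact_mod_cast h3K
        rw [CharP.cast_eq_zero_iff K q, Nat.prime_dvd_prime_iff_eq hqP Nat.prime_three] at this
        subst this
        obtain ⟨l, rfl⟩ := h
        push_cast at hLM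
        have h1 : (p : ℤ) % 3 = 1 := by exact_mod_cast hp3
        have h2 : 4 * (p : ℤ) = 3 * (3 * l ^ 2 + 9 * M ^ 2) := by linarith
        omega
      · have h2 : (q : ℤ) ∣ 2 * a - 3 * B :=
          hqq.dvd_of_dvd_pow (hAL ▸ dvd_pow h two_ne_zero)
        have := congrArg φ idL
        rw [map_mul, map_intCast, hcast _ h2, mul_zero] at this
        simp only [map_mul, map_add, map_ofNat, map_one] at this
        exact this.symm
    · left
      have h2 : (q : ℤ) ∣ B := hqq.dvd_of_dvd_pow (hBM ▸ dvd_pow h two_ne_zero)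
      have := congrArg φ idM
      rw [map_mul, map_intCast, hcast _ h2, mul_zero] at this
      simp only [map_mul, map_sub, map_neg] at this
      linear_combination this
  have fr := eta_frob φ χ ψ (hq := hqz)
  have fin : φ x = φ y ∧ φ y = φ z := by
    rcases hval0 _ hqz with h | h | h
    · exact absurd h hχq
    · apply cyc F _ _ _ _ _ _ hprod
      · rw [hx, fr, h, mul_one]
      · rw [hy, fr, h, ← sq]
      · rw [hz, fr, h, ← pow_succ', h3]
    · have := cyc F (φ x) (φ z) (φ y) ?_ ?_ ?_ ?_
      · exact ⟨this.1.trans this.2, this.2.symm⟩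
      · rw [hx, fr, h, mul_one]
      · rw [hz, fr, h, ← pow_add, pow_succ, h3, one_mul]
      · rw [hy, fr, h, ← pow_succ, h3]
      · rcases hprod with h | ⟨h, h'⟩
        · left; linear_combination -h
        · right; exact ⟨h, by linear_combination h'⟩
  apply hgK
  rw [gx]
  simp only [map_add, map_mul]
  rw [fin.1, fin.2]
  have := congrArg φ hw
  simp only [map_add, map_pow, map_one, map_zero] at this ⊢
  linear_combination φ z * this

end CubicAux

theorem cubic_residue_of_dvd_LM (p : ℕ) (hp : p.Prime) (hp3 : p % 3 = 1)
    (L M : ℤ) (hLM : 4 * (p : ℤ) = L ^ 2 + 27 * M ^ 2)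
    (q : ℕ) (hq : q.Prime) (hdvd : (q : ℤ) ∣ L * M) :
    ∃ x : ℤ, x ^ 3 ≡ (q : ℤ) [ZMOD (p : ℤ)] := by
  by_cases hqp : q = p
  · refine ⟨0, ?_⟩
    subst hqp
    exact (Int.modEq_iff_dvd.mpr (by simp))
  have : Fact p.Prime := ⟨hp⟩
  have : Fact q.Prime := ⟨hq⟩
  obtain ⟨R, _, _, _, K, _, _, φ, ω, ζ, hω, hζ⟩ := CubicAux.exists_ring p q hp hq
  obtain ⟨x, hx⟩ := CubicAux.core hp3 φ ω ζ hω hζ L M hLM hdvd hqp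
  obtain ⟨n, rfl⟩ := ZMod.intCast_surjective x
  refine ⟨n, ?_⟩
  rw [← ZMod.intCast_eq_intCast_iff]
  push_cast
  exact hx
end

section
/- Let p be a prime with p ≡ 1 (mod 4), and let L, M be integers with p = L² + 4M². Let q be an odd prime with q ≠ p. Then q* is a biquadratic residue modulo p if and only if there exists an integer x with M·(x⁴ − 6x² + 1) ≡ 2L·(x³ − x) (mod q). -/
lemma bqr_poly {K : Type*} [Field K] (h2 : (2:K) ≠ 0) (i u v x : K) (hi : i * i = -1) :
    v * (x ^ 4 - 6 * x ^ 2 + 1) = 4 * u * (x ^ 3 - x) ↔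
    (u - v * i) * (x + i) ^ 4 = (u + v * i) * (x - i) ^ 4 := by
  have hi0 : i ≠ 0 := by rintro rfl; simp at hi
  have key : (u - v * i) * (x + i) ^ 4 - (u + v * i) * (x - i) ^ 4
      = 2 * i * (4 * u * (x ^ 3 - x) - v * (x ^ 4 - 6 * x ^ 2 + 1)) := by
    have e2 : i ^ 2 = -1 := by rw [sq, hi]
    have e3 : i ^ 3 = -i := by rw [pow_succ, e2]; ring
    have e4 : i ^ 4 = 1 := by rw [pow_succ, e3]; linear_combination -hi
    have e5 : i ^ 5 = i := by rw [pow_succ, e4]; ring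
    ring_nf
    simp only [e2, e3, e4, e5]
    ring
  constructor
  · intro h
    rw [← sub_eq_zero, key, h]; ring
  · intro h
    rw [h, sub_self] at key
    have := (mul_eq_zero.mp key.symm).resolve_left (mul_ne_zero h2 hi0)
    exact (sub_eq_zero.mp this).symm

lemma bqr_prime_field {K : Type*} [Field K] (q : ℕ) [Fact q.Prime] [CharP K q] (x : K)
    (hx : x ^ q = x) : ∃ n : ℤ, x = n := by
  have := (Subfield.mem_bot_iff_pow_eq_self K q (x := x)).2 hx
  have h2 : (⊥ : Subfield K) ≤ (ZMod.castHom (dvd_refl q) K).fieldRange := bot_le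
  obtain ⟨z, rfl⟩ := h2 this
  obtain ⟨n, rfl⟩ := ZMod.intCast_surjective z
  exact ⟨n, by simp⟩

lemma bqr_int_pow {K : Type*} [Field K] (q : ℕ) [Fact q.Prime] [CharP K q] (n : ℤ) :
    (n : K) ^ q = n := by
  have : ((n : ZMod q)) ^ q = n := ZMod.pow_card _
  have := congrArg (ZMod.castHom (dvd_refl q) K) this
  rw [map_pow, map_intCast] at this
  exact this

lemma bqr_alg {K : Type*} [Field K] (q : ℕ) [Fact q.Prime] [CharP K q] (h2 : (2:K) ≠ 0)
    (i h c : K) (u v : ℤ) (hi : i * i = -1)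
    (hJ : (u + v * i : K) ≠ 0) (hJb : (u - v * i : K) ≠ 0)
    (h4 : h ^ 4 * (u + v * i) = u - v * i)
    (H : (q % 4 = 1 ∧ h ^ q = c * h) ∨ (q % 4 = 3 ∧ h ^ q * h = c)) :
    c = 1 ↔ ∃ x : ℤ, (v : K) * ((x:K) ^ 4 - 6 * (x:K) ^ 2 + 1) = 4 * u * ((x:K) ^ 3 - x) := by
  have hi0 : i ≠ 0 := by rintro rfl; simp at hi
  have i4 : i ^ 4 = 1 := by linear_combination (i*i - 1) * hi
  have h0 : h ≠ 0 := by
    rintro rfl; apply hJb; rw [← h4]; simp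
  have hi1 : q % 4 = 1 → i ^ q = i := by
    intro hq
    rw [← Nat.div_add_mod q 4, hq, pow_add, pow_mul, i4]; simp
  have hi3 : q % 4 = 3 → i ^ q = -i := by
    intro hq
    rw [← Nat.div_add_mod q 4, hq, pow_add, pow_mul, i4]; simp
    linear_combination i * hi
  constructor
  · rintro rfl
    by_cases h1 : h = 1
    · refine ⟨0, ?_⟩
      subst h1
      have : (2 * i) * (v : K) = 0 := by linear_combination h4
      have := (mul_eq_zero.mp this).resolve_left (mul_ne_zero h2 hi0)
      simp [this]
    · have h1' : h - 1 ≠ 0 := sub_ne_zero.mpr h1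
      obtain ⟨n, hn⟩ := bqr_prime_field q (-i * (h + 1) / (h - 1)) (by
        have hodd : Odd q := by
          rcases H with ⟨a, _⟩ | ⟨a, _⟩ <;> rw [Nat.odd_iff] <;> omega
        rw [div_pow, mul_pow, add_pow_char, sub_pow_char, one_pow, hodd.neg_pow]
        rcases H with ⟨a, b⟩ | ⟨a, b⟩
        · rw [hi1 a, b, one_mul]
        · rw [hi3 a]
          have : h ^ q = h⁻¹ := eq_inv_of_mul_eq_one_left b
          rw [this]
          have : h⁻¹ - 1 ≠ 0 := by
            intro e; apply h1; exact inv_eq_one.mp (sub_eq_zero.mp e)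
          rw [div_eq_div_iff this h1']
          field_simp
          ring)
      refine ⟨n, ?_⟩
      rw [bqr_poly h2 i _ _ _ hi, ← hn, ← h4]
      have e1 : -i * (h + 1) / (h - 1) + i = -2 * i / (h - 1) := by field_simp; ring
      have e2 : -i * (h + 1) / (h - 1) - i = h * (-2 * i / (h - 1)) := by field_simp; ring
      rw [e1, e2]; ring
  · rintro ⟨x, hx⟩
    rw [bqr_poly h2 i _ _ _ hi] at hx
    have hxm : (x : K) - i ≠ 0 := by
      intro e
      have e' : (x : K) = i := sub_eq_zero.mp e
      rw [e'] at hx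
      have : (u - v * i : K) * (2 * i) ^ 4 = 0 := by
        rw [two_mul, hx]; ring
      exact mul_ne_zero hJb (pow_ne_zero _ (mul_ne_zero h2 hi0)) this
    have hxp : (x : K) + i ≠ 0 := by
      intro e
      have e' : (x : K) = -i := eq_neg_of_add_eq_zero_left e
      rw [e'] at hx
      have : (u + v * i : K) * (2 * i) ^ 4 = 0 := by
        have : (2 * i) ^ 4 = (-i - i) ^ 4 := by ring
        rw [this, ← hx]; ring
      exact mul_ne_zero hJ (pow_ne_zero _ (mul_ne_zero h2 hi0)) this
    set y : K := (x - i) / (x + i) with hy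
    have hy0 : y ≠ 0 := div_ne_zero hxm hxp
    have hy4 : y ^ 4 = h ^ 4 := by
      rw [hy, div_pow, div_eq_iff (pow_ne_zero _ hxp)]
      apply mul_left_cancel₀ hJ
      rw [← hx, ← h4]; ring
    set w : K := h / y with hw
    have hhw : h = w * y := by rw [hw]; field_simp
    have hw4 : w ^ 4 = 1 := by
      rw [hw, div_pow, hy4, div_self (pow_ne_zero _ h0)]
    have xq := bqr_int_pow (K := K) q x
    rcases H with ⟨a, b⟩ | ⟨a, b⟩
    · have hwq : w ^ q = w := by
        rw [← Nat.div_add_mod q 4, a, pow_add, pow_mul, hw4]; simp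
      have hyq : y ^ q = y := by
        rw [hy, div_pow, add_pow_char, sub_pow_char, xq, hi1 a]
      have : h ^ q = h := by rw [hhw, mul_pow, hwq, hyq]
      rw [this] at b
      exact (mul_eq_right₀ h0).mp b.symm
    · have hwq : w ^ q * w = 1 := by
        rw [← pow_succ, ← Nat.div_add_mod q 4, a, add_assoc, pow_add, pow_mul, hw4]; simp [hw4]
      have hyq : y ^ q * y = 1 := by
        rw [hy, div_pow, add_pow_char, sub_pow_char, xq, hi3 a, sub_neg_eq_add, ← sub_eq_add_neg]
        field_simp
      rw [← b, hhw, mul_pow]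
      linear_combination (w ^ q * w) * hyq + hwq

lemma bqr_residue {K : Type*} [Field K] (p : ℕ) [Fact p.Prime] (χ : MulChar (ZMod p) K)
    (h4 : χ ^ 4 = 1) (h2 : χ ^ 2 ≠ 1) (a : ZMod p) (ha : a ≠ 0) :
    χ a = 1 ↔ ∃ x : ZMod p, x ^ 4 = a := by
  constructor
  · intro h
    obtain ⟨g, hg⟩ := IsCyclic.exists_monoid_generator (α := (ZMod p)ˣ)
    obtain ⟨k, hk⟩ := hg (Units.mk0 a ha)
    have hk' : (g : ZMod p) ^ k = a := by
      have := congrArg Units.val hk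
      simpa using this
    have g4 : χ g ^ 4 = 1 := by
      rw [← MulChar.pow_apply_coe, h4, MulChar.one_apply_coe]
    have g2 : χ g ^ 2 ≠ 1 := by
      intro e
      apply h2
      ext b
      obtain ⟨m, rfl⟩ := hg b
      rw [MulChar.pow_apply_coe, MulChar.one_apply_coe]
      push_cast
      rw [map_pow, ← pow_mul, mul_comm, pow_mul, e, one_pow]
    have hgk : χ g ^ k = 1 := by rw [← map_pow, hk', h]
    have hd : k % 4 = 0 := by
      rw [← Nat.div_add_mod k 4, pow_add, pow_mul, g4, one_pow, one_mul] at hgk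
      have : k % 4 < 4 := Nat.mod_lt _ (by norm_num)
      interval_cases hm : k % 4
      · rfl
      · rw [pow_one] at hgk; rw [hgk] at g2; simp at g2
      · exact absurd hgk g2
      · have : χ g = 1 := by
          have := g4
          rw [pow_succ, hgk, one_mul] at this; exact this
        rw [this] at g2; simp at g2
    refine ⟨(g : ZMod p) ^ (k / 4), ?_⟩
    rw [← pow_mul, Nat.div_mul_cancel (Nat.dvd_of_mod_eq_zero hd), hk']
  · rintro ⟨x, rfl⟩
    have hx : x ≠ 0 := by rintro rfl; simp at ha
    rw [map_pow, ← MulChar.pow_apply' _ (by norm_num), h4]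
    exact MulChar.one_apply (isUnit_iff_ne_zero.mpr hx)

lemma bqr_gauss {K : Type*} [Field K] [IsAlgClosed K] (p q : ℕ) [Fact p.Prime] [Fact q.Prime]
    [CharP K q] (hqp : q ≠ p) (hqo : q % 4 = 1 ∨ q % 4 = 3)
    (χ : MulChar (ZMod p) K) (h4 : χ ^ 4 = 1) (h2 : χ ^ 2 ≠ 1) :
    ∃ g : K, g ≠ 0 ∧ g ^ 4 = p * (jacobiSum χ χ) ^ 2 ∧
      ((q % 4 = 1 ∧ g ^ q * χ q = g) ∨ (q % 4 = 3 ∧ g ^ q * g = χ (-q) * p)) := by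
  have hpK : (p : K) ≠ 0 := by
    rw [Ne, CharP.cast_eq_zero_iff K q, Nat.prime_dvd_prime_iff_eq Fact.out Fact.out]
    exact hqp
  have hqF : (q : ZMod p) ≠ 0 := by
    rw [Ne, ZMod.natCast_eq_zero_iff, Nat.prime_dvd_prime_iff_eq Fact.out Fact.out]
    exact hqp.symm
  have : NeZero (p : K) := ⟨hpK⟩
  obtain ⟨ζ, hζ⟩ := HasEnoughRootsOfUnity.exists_primitiveRoot K p
  set ψ := AddChar.zmodChar p ((IsPrimitiveRoot.iff_def ζ p).mp hζ).left with hψd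
  have hψ : ψ.IsPrimitive := AddChar.zmodChar_primitive_of_primitive_root p hζ
  have h1 : χ ≠ 1 := by rintro rfl; simp at h2
  have hcard : ((Fintype.card (ZMod p) : ℕ) : K) = p := by rw [ZMod.card]
  have hinv : χ⁻¹ = χ ^ 3 := by
    rw [inv_eq_iff_mul_eq_one, ← pow_succ', h4]
  refine ⟨gaussSum χ ψ, ?_, ?_, ?_⟩
  · exact gaussSum_ne_zero_of_nontrivial (by rwa [hcard]) h1 hψ
  · have e := jacobiSum_mul_nontrivial (χ := χ) (φ := χ) (by rwa [← sq]) ψ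
    rw [← sq, ← sq] at e
    have hquad : (χ ^ 2).IsQuadratic := by
      intro a
      by_cases ha : a = 0
      · left; rw [ha]; exact MulChar.map_nonunit _ (by simp)
      · right
        rw [MulChar.pow_apply' _ (by norm_num)]
        have : (χ a ^ 2) ^ 2 = 1 := by
          rw [← pow_mul, ← MulChar.pow_apply' _ (by norm_num), h4]
          exact MulChar.one_apply (isUnit_iff_ne_zero.mpr ha)
        exact sq_eq_one_iff.mp this
    have e2 := gaussSum_sq h2 hquad hψ
    rw [MulChar.pow_apply' _ (by norm_num), ← map_pow, neg_one_sq, map_one, one_mul, hcard] at e2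
    rw [← e2, ← mul_pow, e]; ring
  · have key : χ q ^ q * gaussSum χ ψ ^ q = gaussSum (χ ^ q) ψ := by
      rw [gaussSum_frob, AddChar.pow_mulShift, ← MulChar.pow_apply' _ (Fact.out : q.Prime).ne_zero]
      exact gaussSum_mulShift (χ ^ q) ψ (Units.mk0 (q : ZMod p) hqF)
    have c4 : χ q ^ 4 = 1 := by
      rw [← MulChar.pow_apply' _ (by norm_num), h4]
      exact MulChar.one_apply (isUnit_iff_ne_zero.mpr hqF)
    rcases hqo with a | a
    · left
      refine ⟨a, ?_⟩
      have e1 : χ ^ q = χ := by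
        rw [← Nat.div_add_mod q 4, a, pow_add, pow_mul, h4]; simp
      have e2 : χ q ^ q = χ q := by
        rw [← MulChar.pow_apply' _ (Fact.out : q.Prime).ne_zero, e1]
      rw [e1, e2] at key
      rw [mul_comm, key]
    · right
      refine ⟨a, ?_⟩
      have e1 : χ ^ q = χ ^ 3 := by
        conv_lhs => rw [← Nat.div_add_mod q 4, a, pow_add, pow_mul, h4]
        simp
      have e2 : χ q ^ q = χ q ^ 3 := by
        rw [← MulChar.pow_apply' _ (Fact.out : q.Prime).ne_zero, e1,
          MulChar.pow_apply' _ (by norm_num)]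
      rw [e1, e2, ← hinv] at key
      have e3 := gaussSum_mul_gaussSum_eq_card h1 hψ
      rw [hcard] at e3
      have e4 := mul_gaussSum_inv_eq_gaussSum χ⁻¹ ψ
      have e5 : χ⁻¹ (-1) = χ (-1) := by rw [MulChar.inv_apply']; norm_num
      rw [e5] at e4
      have e6 : χ (-q : ZMod p) = χ (-1) * χ q := by rw [← map_mul]; simp
      rw [e6]
      calc _ = (χ q ^ 4) * (gaussSum χ ψ ^ q * gaussSum χ ψ) := by rw [c4, one_mul]
        _ = χ q * ((χ q ^ 3 * gaussSum χ ψ ^ q) * gaussSum χ ψ) := by ring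
        _ = _ := by rw [key, ← e4, ← e3]; ring

lemma bqr_char (p : ℕ) [Fact p.Prime] (hp4 : p % 4 = 1) :
    ∃ χ : MulChar (ZMod p) GaussianInt, χ ^ 4 = 1 ∧ (∃ a, χ a ^ 2 = -1) ∧
      Even (jacobiSum χ χ).im ∧
      (jacobiSum χ χ).re ^ 2 + (jacobiSum χ χ).im ^ 2 = p := by
  let I : GaussianInt := ⟨0, 1⟩
  have hI2 : I ^ 2 = -1 := by rw [sq]; rfl
  have hI : IsPrimitiveRoot I 4 := by
    refine IsPrimitiveRoot.mk_of_lt I (by norm_num) ?_ ?_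
    · rw [show 4 = 2 * 2 from rfl, pow_mul, hI2]; norm_num
    · intro l h0 h4
      interval_cases l
      · decide
      · decide
      · decide
  have hdvd : 4 ∣ Fintype.card (ZMod p) - 1 := by rw [ZMod.card]; omega
  obtain ⟨χ, hχ⟩ := MulChar.exists_mulChar_orderOf (ZMod p) hdvd hI
  have h4 : χ ^ 4 = 1 := by rw [← hχ, pow_orderOf_eq_one]
  have h2 : χ ^ 2 ≠ 1 := pow_ne_one_of_lt_orderOf (by norm_num) (by omega)
  have h1 : χ ≠ 1 := by rintro rfl; simp at h2
  refine ⟨χ, h4, ?_, ?_, ?_⟩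
  · obtain ⟨a, ha⟩ := MulChar.ne_one_iff.mp h2
    refine ⟨a, ?_⟩
    rw [MulChar.pow_apply_coe] at ha
    have : (χ a ^ 2) ^ 2 = 1 := by
      rw [← pow_mul, ← MulChar.pow_apply_coe, h4, MulChar.one_apply_coe]
    exact (sq_eq_one_iff.mp this).resolve_left ha
  · obtain ⟨z, -, hz⟩ := exists_jacobiSum_eq_neg_one_add (by norm_num) h4 h4 hdvd hI
    have : (I - 1) ^ 2 = ⟨0, -2⟩ := by rw [sq]; rfl
    rw [hz, this]
    simp
  · set f := GaussianInt.toComplex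
    have hf : Function.Injective f := GaussianInt.toComplex_injective
    have e := jacobiSum_mul_jacobiSum_inv (F' := ℂ) (χ := χ.ringHomComp f) (φ := χ.ringHomComp f)
      (by rw [ringChar.eq ℂ 0, ZMod.ringChar_zmod_n]; exact (Fact.out : p.Prime).ne_zero.symm)
      ((MulChar.ringHomComp_ne_one_iff hf).mpr h1) ((MulChar.ringHomComp_ne_one_iff hf).mpr h1)
      (by rw [← MulChar.ringHomComp_mul, ← sq]; exact (MulChar.ringHomComp_ne_one_iff hf).mpr h2)
    have es : jacobiSum (χ.ringHomComp f)⁻¹ (χ.ringHomComp f)⁻¹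
        = (starRingEnd ℂ) (jacobiSum (χ.ringHomComp f) (χ.ringHomComp f)) := by
      rw [← jacobiSum_ringHomComp]
      have : (χ.ringHomComp f)⁻¹ = (χ.ringHomComp f).ringHomComp (starRingEnd ℂ) := by
        ext a
        rw [← MulChar.star_apply']; rfl
      rw [this]
    rw [es, Complex.mul_conj, jacobiSum_ringHomComp, ZMod.card] at e
    have e' : Complex.normSq (f (jacobiSum χ χ)) = p := by exact_mod_cast e
    rw [Complex.normSq_apply] at e'
    rw [← GaussianInt.intCast_re, ← GaussianInt.intCast_im] at e'
    have : ((jacobiSum χ χ).re : ℝ) ^ 2 + ((jacobiSum χ χ).im : ℝ) ^ 2 = p := by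
      rw [← e']; ring
    exact_mod_cast this

lemma bqr_unique (p : ℕ) (hp : p.Prime) (u v L N : ℤ) (h1 : u ^ 2 + v ^ 2 = p)
    (h2 : L ^ 2 + N ^ 2 = p) (hv : Even v) (hN : Even N) (hpo : Odd p) :
    (u = L ∨ u = -L) ∧ (v = N ∨ v = -N) := by
  have hp0 : (p : ℤ) ≠ 0 := by exact_mod_cast hp.ne_zero
  have hpo' : Odd (p : ℤ) := by exact_mod_cast hpo
  have hu : Odd u := by
    rw [← h1] at hpo'; simpa [parity_simps, hv] using hpo'
  have hL : Odd L := by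
    rw [← h2] at hpo'; simpa [parity_simps, hN] using hpo'
  have suff : ∀ N : ℤ, Even N → L ^ 2 + N ^ 2 = p → (p : ℤ) ∣ u * N - v * L → u ^ 2 = L ^ 2 := by
    intro N hN h2 hd
    have id1 : (u * L + v * N) ^ 2 + (u * N - v * L) ^ 2 = (p : ℤ) ^ 2 := by
      rw [sq (p : ℤ)]; nth_rewrite 1 [← h1]; rw [← h2]; ring
    have hodd : Odd (u * L + v * N) := by
      simp [parity_simps, hv, hu, hL]
    have hne : u * L + v * N ≠ 0 := by rintro e; rw [e] at hodd; simp at hodd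
    obtain ⟨k, hk⟩ := hd
    have hk0 : k = 0 := by
      by_contra hk0
      have a1 : 1 ≤ k ^ 2 := by have := sq_nonneg k; have : k ^ 2 ≠ 0 := pow_ne_zero _ hk0; omega
      have a2 : 0 < (u * L + v * N) ^ 2 := by positivity
      rw [hk] at id1
      nlinarith [sq_nonneg (p : ℤ)]
    rw [hk0, mul_zero] at hk
    have : (p : ℤ) * (u ^ 2 - L ^ 2) = 0 := by
      have e : (p : ℤ) * (u ^ 2 - L ^ 2) = (u * N - v * L) * (u * N + v * L) := by
        linear_combination L ^ 2 * h1 - u ^ 2 * h2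
      rw [e, hk, zero_mul]
    have := (mul_eq_zero.mp this).resolve_left hp0
    linarith
  have huL : u ^ 2 = L ^ 2 := by
    have e : (u * N - v * L) * (u * N + v * L) = (p : ℤ) * (u ^ 2 - L ^ 2) := by
      linear_combination u ^ 2 * h2 - L ^ 2 * h1
    have : (p : ℤ) ∣ (u * N - v * L) * (u * N + v * L) := ⟨_, e⟩
    rcases (Nat.prime_iff_prime_int.mp hp).dvd_or_dvd this with h | h
    · exact suff N hN h2 h
    · refine suff (-N) hN.neg (by rw [← h2]; ring) ?_
      have : u * -N - v * L = -(u * N + v * L) := by ring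
      rw [this]; exact h.neg_right
  exact ⟨sq_eq_sq_iff_eq_or_eq_neg.mp huL, sq_eq_sq_iff_eq_or_eq_neg.mp (by linarith)⟩

theorem bqr_aux (K : Type*) [Field K] [IsAlgClosed K] (p : ℕ) (hp : p.Prime) (hp4 : p % 4 = 1)
    (L M : ℤ) (hLM : (p : ℤ) = L ^ 2 + 4 * M ^ 2)
    (q : ℕ) (hq : q.Prime) (hq2 : Odd q) (hqp : q ≠ p) [CharP K q] :
    (∃ x : ℤ, x ^ 4 ≡ (-1) ^ ((q - 1) / 2) * (q : ℤ) [ZMOD (p : ℤ)]) ↔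
      ∃ x : ℤ, M * (x ^ 4 - 6 * x ^ 2 + 1) ≡ 2 * L * (x ^ 3 - x) [ZMOD (q : ℤ)] := by
  have : Fact p.Prime := ⟨hp⟩
  have : Fact q.Prime := ⟨hq⟩
  have hqo : q % 4 = 1 ∨ q % 4 = 3 := by rw [Nat.odd_iff] at hq2; omega
  have h2 : (2 : K) ≠ 0 := by
    have : ((2 : ℕ) : K) ≠ 0 := by
      rw [Ne, CharP.cast_eq_zero_iff K q, Nat.prime_dvd_prime_iff_eq hq Nat.prime_two]
      rintro rfl
      simp at hqo
    exact_mod_cast this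
  have hpK : (p : K) ≠ 0 := by
    rw [Ne, CharP.cast_eq_zero_iff K q, Nat.prime_dvd_prime_iff_eq hq hp]
    exact hqp
  have hqF : (q : ZMod p) ≠ 0 := by
    rw [Ne, ZMod.natCast_eq_zero_iff, Nat.prime_dvd_prime_iff_eq hp hq]
    exact hqp.symm
  obtain ⟨i, hi⟩ := IsAlgClosed.exists_pow_nat_eq (-1 : K) (n := 2) (by norm_num)
  rw [sq] at hi
  obtain ⟨χ₀, hχ4, ⟨a, ha⟩, hev, hnorm⟩ := bqr_char p hp4
  set u := (jacobiSum χ₀ χ₀).re with hu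
  set v := (jacobiSum χ₀ χ₀).im with hv
  let f : GaussianInt →+* K := Zsqrtd.lift ⟨i, by rw [hi]; simp⟩
  set χ := χ₀.ringHomComp f with hχ
  have h4 : χ ^ 4 = 1 := by rw [hχ, MulChar.ringHomComp_pow, hχ4, MulChar.ringHomComp_one]
  have hχ2 : χ ^ 2 ≠ 1 := by
    intro e
    have e1 : (χ ^ 2) a = -1 := by
      rw [MulChar.pow_apply' _ (by norm_num), hχ, MulChar.ringHomComp_apply, ← map_pow, ha]
      simp
    have ha0 : IsUnit a := by
      by_contra h
      rw [MulChar.map_nonunit _ h] at ha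
      revert ha
      norm_num
    rw [e, MulChar.one_apply ha0] at e1
    apply h2
    linear_combination e1
  have hJ : jacobiSum χ χ = u + v * i := by
    rw [hχ, jacobiSum_ringHomComp]; rfl
  have hJJ : (u + v * i : K) * (u - v * i) = p := by
    have : ((u ^ 2 + v ^ 2 : ℤ) : K) = p := by rw [hnorm]; simp
    push_cast at this
    linear_combination this - (v:K) ^ 2 * hi
  have hJ0 : (u + v * i : K) ≠ 0 := left_ne_zero_of_mul (hJJ ▸ hpK)
  have hJb0 : (u - v * i : K) ≠ 0 := right_ne_zero_of_mul (hJJ ▸ hpK)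
  obtain ⟨g, hg0, hg4, hgq⟩ := bqr_gauss p q hqp hqo χ h4 hχ2
  rw [hJ] at hg4
  have i4 : i ^ 4 = 1 := by linear_combination (i*i - 1) * hi
  have Jq : (u + v * i : K) ^ q = u + v * i ^ q := by
    rw [add_pow_char, mul_pow, bqr_int_pow, bqr_int_pow]
  -- the left-hand side in terms of the quartic character
  have hleft : (∃ x : ℤ, x ^ 4 ≡ (-1) ^ ((q - 1) / 2) * (q : ℤ) [ZMOD (p : ℤ)]) ↔
      χ ((-1) ^ ((q - 1) / 2) * (q : ZMod p)) = 1 := by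
    rw [bqr_residue p χ h4 hχ2 _ (mul_ne_zero (pow_ne_zero _ (by simp)) hqF)]
    constructor
    · rintro ⟨x, hx⟩
      refine ⟨x, ?_⟩
      have := (ZMod.intCast_eq_intCast_iff _ _ p).mpr hx
      push_cast at this
      exact this
    · rintro ⟨x, hx⟩
      obtain ⟨n, rfl⟩ := ZMod.intCast_surjective x
      refine ⟨n, (ZMod.intCast_eq_intCast_iff _ _ p).mp ?_⟩
      push_cast
      exact hx
  have hmain : χ ((-1) ^ ((q - 1) / 2) * (q : ZMod p)) = 1 ↔
      ∃ x : ℤ, (v : K) * ((x:K) ^ 4 - 6 * (x:K) ^ 2 + 1) = 4 * u * ((x:K) ^ 3 - x) := by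
    have hh4 : (g / (u + v * i : K)) ^ 4 * (u + v * i) = u - v * i := by
      rw [div_pow, hg4, ← hJJ]
      field_simp
    rcases hgq with ⟨hq1, e⟩ | ⟨hq3, e⟩
    · have hs : Even ((q - 1) / 2) := by rw [Nat.even_iff]; omega
      rw [hs.neg_one_pow, one_mul]
      have hc0 : χ q ≠ 0 := by
        intro h; rw [h, mul_zero] at e; exact hg0 e.symm
      have hiq : i ^ q = i := by
        rw [← Nat.div_add_mod q 4, hq1, pow_add, pow_mul, i4]; simp
      rw [← bqr_alg q h2 i (g / (u + v * i)) (χ q)⁻¹ u v hi hJ0 hJb0 hh4 (Or.inl ⟨hq1, ?_⟩)]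
      · exact inv_eq_one.symm
      · rw [div_pow, Jq, hiq, ← mul_div_assoc]
        congr 1
        field_simp
        exact e
    · have hs : Odd ((q - 1) / 2) := by rw [Nat.odd_iff]; omega
      rw [hs.neg_one_pow, neg_one_mul]
      have hiq : i ^ q = -i := by
        rw [← Nat.div_add_mod q 4, hq3, pow_add, pow_mul, i4]; simp
        linear_combination i * hi
      rw [← bqr_alg q h2 i (g / (u + v * i)) (χ (-q)) u v hi hJ0 hJb0 hh4 (Or.inr ⟨hq3, ?_⟩)]
      rw [div_pow, Jq, hiq, div_mul_div_comm, e, ← hJJ, mul_neg, ← sub_eq_add_neg]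
      field_simp
  have hright : ∀ x : ℤ, (M * (x ^ 4 - 6 * x ^ 2 + 1) ≡ 2 * L * (x ^ 3 - x) [ZMOD (q : ℤ)]) ↔
      ((2 * M : ℤ) : K) * ((x:K) ^ 4 - 6 * (x:K) ^ 2 + 1) = 4 * L * ((x:K) ^ 3 - x) := by
    intro x
    rw [← CharP.intCast_eq_intCast K q]
    push_cast
    constructor
    · intro h; linear_combination 2 * h
    · intro h
      apply mul_left_cancel₀ h2
      linear_combination h
  rw [hleft, hmain]
  simp only [hright]
  obtain ⟨hA, hB⟩ := bqr_unique p hp u v L (2 * M) hnorm (by rw [hLM]; ring) hev (by simp)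
    (by rw [Nat.odd_iff]; omega)
  rcases hA with hA | hA <;> rcases hB with hB | hB <;> rw [hA, hB] <;> push_cast
  · constructor <;> rintro ⟨x, hx⟩ <;> refine ⟨-x, ?_⟩ <;> push_cast <;>
      linear_combination -hx
  · constructor <;> rintro ⟨x, hx⟩ <;> refine ⟨-x, ?_⟩ <;> push_cast <;>
      linear_combination hx
  · constructor <;> rintro ⟨x, hx⟩ <;> refine ⟨x, ?_⟩ <;> linear_combination -hx

/-- Sun's rational criterion for biquadratic residuacity: if p ≡ 1 (mod 4) is prime,
p = L² + 4M², and q is an odd prime, q ≠ p, then q* = (-1)^((q-1)/2)·q is a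
biquadratic residue mod p iff M(x⁴ - 6x² + 1) ≡ 2L(x³ - x) (mod q) is solvable. -/
theorem biquadratic_residue_criterion (p : ℕ) (hp : p.Prime) (hp4 : p % 4 = 1)
    (L M : ℤ) (hLM : (p : ℤ) = L ^ 2 + 4 * M ^ 2)
    (q : ℕ) (hq : q.Prime) (hq2 : Odd q) (hqp : q ≠ p) :
    (∃ x : ℤ, x ^ 4 ≡ (-1) ^ ((q - 1) / 2) * (q : ℤ) [ZMOD (p : ℤ)]) ↔
      ∃ x : ℤ, M * (x ^ 4 - 6 * x ^ 2 + 1) ≡ 2 * L * (x ^ 3 - x) [ZMOD (q : ℤ)] := by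
  have : Fact q.Prime := ⟨hq⟩
  have : CharP (AlgebraicClosure (ZMod q)) q :=
    charP_of_injective_algebraMap (algebraMap (ZMod q) (AlgebraicClosure (ZMod q))).injective q
  exact bqr_aux (AlgebraicClosure (ZMod q)) p hp hp4 L M hLM q hq hq2 hqp
end

section
/- Let p be a prime with p ≡ 1 (mod 3), let L, M be integers with 4p = L² + 27M², and let q be a prime with q ≠ p that does not divide 6·L·M. If there exists an integer m such that q divides M·(m³ − 9m) + L·(m² − 1), then q is a cubic residue modulo p. -/
lemma key_field {p q : ℕ} [Fact p.Prime] [Fact q.Prime] (hqp : q ≠ p) (hq2 : q ≠ 2) (hq3 : q ≠ 3)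
    {K : Type} [Field K] [CharP K q] (χ : MulChar (ZMod p) K) (hχ : χ ≠ 1) (hχ3 : χ ^ 3 = 1)
    (ψ : AddChar (ZMod p) K) (hψ : ψ.IsPrimitive) (w : K) (hw : w ^ 2 + w + 1 = 0)
    (L M m : ℤ) (hJ : 2 * jacobiSum χ χ = L + 3 * M * (1 + 2 * w))
    (hJ' : 2 * jacobiSum χ⁻¹ χ⁻¹ = L - 3 * M * (1 + 2 * w))
    (hm : (M : K) * (m ^ 3 - 9 * m) + L * (m ^ 2 - 1) = 0) : χ (q : ZMod p) = 1 := by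
  have hp : p.Prime := Fact.out
  have hq : q.Prime := Fact.out
  have hpK : (p : K) ≠ 0 := by
    rw [Ne, CharP.cast_eq_zero_iff K q, Nat.prime_dvd_prime_iff_eq hq hp]; exact hqp
  have h2K : (2 : K) ≠ 0 := by
    have : ((2 : ℕ) : K) ≠ 0 := by
      rw [Ne, CharP.cast_eq_zero_iff K q, Nat.prime_dvd_prime_iff_eq hq Nat.prime_two]; exact hq2
    exact_mod_cast this
  have h3K : (3 : K) ≠ 0 := by
    have : ((3 : ℕ) : K) ≠ 0 := by
      rw [Ne, CharP.cast_eq_zero_iff K q, Nat.prime_dvd_prime_iff_eq hq Nat.prime_three]; exact hq3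
    exact_mod_cast this
  have hw3 : w ^ 3 = 1 := by linear_combination (w - 1) * hw
  have hinv : χ ^ 2 = χ⁻¹ := by
    rw [eq_inv_iff_mul_eq_one, ← pow_succ]; exact hχ3
  have hinv2 : χ⁻¹ ^ 2 = χ := by
    rw [inv_pow, hinv, inv_inv]
  have hχi : χ⁻¹ ≠ 1 := by simpa using hχ
  have hqz : (q : ZMod p) ≠ 0 := by
    rw [Ne, CharP.cast_eq_zero_iff (ZMod p) p, Nat.prime_dvd_prime_iff_eq hp hq]; exact hqp.symm
  have hm1 : χ (-1) = 1 := by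
    have h1 : χ (-1) ^ 2 = 1 := by rw [← map_pow]; simp
    have h2 : χ (-1) ^ 3 = 1 := by
      rw [← MulChar.pow_apply' _ (by norm_num), hχ3, MulChar.one_apply (by simp)]
    rw [pow_succ, h1, one_mul] at h2; exact h2
  have ht3 : χ q ^ 3 = 1 := by
    rw [← MulChar.pow_apply' _ (by norm_num), hχ3, MulChar.one_apply (by simpa using hqz)]
  have hti : χ⁻¹ (q : ZMod p) = χ q ^ 2 := by
    rw [← hinv, MulChar.pow_apply' _ (by norm_num)]
  set t := χ (q : ZMod p) with ht
  set g := gaussSum χ ψ with hg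
  set g' := gaussSum χ⁻¹ ψ with hg'
  have hgg : g * g' = p := by
    have := gaussSum_mul_gaussSum_eq_card hχ hψ
    have h2 := mul_gaussSum_inv_eq_gaussSum χ⁻¹ ψ
    rw [← hinv, MulChar.pow_apply' _ (by norm_num), hm1, hinv, one_pow, one_mul] at h2
    rw [h2, ZMod.card] at this
    exact this
  have hg0 : g ≠ 0 := by intro h; rw [h, zero_mul] at hgg; exact hpK hgg.symm
  have hg0' : g' ≠ 0 := by intro h; rw [h, mul_zero] at hgg; exact hpK hgg.symm
  have e1 : g' * jacobiSum χ χ = g ^ 2 := by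
    have := jacobiSum_mul_nontrivial (χ := χ) (φ := χ) (by rw [← pow_two, hinv]; exact hχi) ψ
    rw [← pow_two, hinv] at this
    rw [hg', this, pow_two]
  have e2 : g * jacobiSum χ⁻¹ χ⁻¹ = g' ^ 2 := by
    have := jacobiSum_mul_nontrivial (χ := χ⁻¹) (φ := χ⁻¹) (by rw [← pow_two, hinv2]; exact hχ) ψ
    rw [← pow_two, hinv2] at this
    rw [hg, this, pow_two]
  have hfr : ∀ φ : MulChar (ZMod p) K,
      gaussSum φ ψ ^ q = (φ ^ q)⁻¹ (q : ZMod p) * gaussSum (φ ^ q) ψ := by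
    intro φ
    rw [gaussSum_frob q, AddChar.pow_mulShift]
    have := gaussSum_mulShift_eq (φ ^ q) ψ (Units.mk0 (q : ZMod p) hqz)
    simpa using this
  set J := jacobiSum χ χ
  set J' := jacobiSum χ⁻¹ χ⁻¹
  have hJ0 : J ≠ 0 := by
    intro h; rw [h, mul_zero] at e1; exact hg0 (pow_eq_zero_iff (by norm_num) |>.1 e1.symm)
  have hJ0' : J' ≠ 0 := by
    intro h; rw [h, mul_zero] at e2; exact hg0' (pow_eq_zero_iff (by norm_num) |>.1 e2.symm)
  set s := 1 + 2 * w with hs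
  have hs2 : s ^ 2 = -3 := by rw [hs]; linear_combination 4 * hw
  have hs0 : s ≠ 0 := by
    intro h; rw [h] at hs2; apply h3K; linear_combination hs2
  have e3 : J * (m + s) ^ 3 = J' * (m - s) ^ 3 := by
    apply mul_left_cancel₀ h2K
    linear_combination (m + s) ^ 3 * hJ - (m - s) ^ 3 * hJ' + 6 * s * hm +
      (2 * L * s + 18 * M * m * s) * hs2
  have hms : (m + s : K) ≠ 0 := by
    intro h
    rw [h] at e3
    have h2 : J' * (m - s) ^ 3 = 0 := by rw [← e3]; simp
    have h3 : (m - s : K) = 0 := by simpa [hJ0'] using h2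
    have : 2 * s = 0 := by linear_combination h - h3
    simp [h2K, hs0] at this
  have e4 : ((m - s) * g') ^ 3 = ((m + s) * g) ^ 3 := by
    apply mul_left_cancel₀ hJ0
    apply mul_left_cancel₀ hg0
    apply mul_left_cancel₀ hg0'
    linear_combination (-g^4 * g') * e3 + (m-s)^3 * (g * g'^3 * e1 - g' * g ^3 * e2)
  have e5 : ∃ c : K, c ^ 3 = 1 ∧ (m - s) * g' = c * ((m + s) * g) := by
    refine ⟨(m - s) * g' / ((m + s) * g), ?_, ?_⟩
    · rw [div_pow, e4, div_self]; positivity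
    · field_simp
  obtain ⟨c, hc, e5⟩ := e5
  have e6 := congrArg (frobenius K q) e5
  simp only [map_mul, map_add, map_sub, map_intCast, hs, map_one, map_ofNat] at e6
  simp only [frobenius_def] at e6
  rw [hfr, hfr] at e6
  have hY : (m + s) * g ≠ 0 := mul_ne_zero hms hg0
  have ht0 : t ≠ 0 := by intro h; rw [h] at ht3; simp at ht3
  have hq3' : q % 3 = 1 ∨ q % 3 = 2 := by
    have : ¬ 3 ∣ q := by
      rw [Nat.prime_dvd_prime_iff_eq Nat.prime_three hq]; exact fun h => hq3 h.symm
    omega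
  have hpow : ∀ {G : Type} [Monoid G] (x : G), x ^ 3 = 1 → x ^ q = x ^ (q % 3) := by
    intro G _ x hx
    conv_lhs => rw [← Nat.div_add_mod q 3, pow_add, pow_mul, hx, one_pow, one_mul]
  have hχi3 : χ⁻¹ ^ 3 = 1 := by rw [inv_pow, hχ3, inv_one]
  rw [hpow c hc, hpow w hw3, hpow χ hχ3, hpow _ hχi3] at e6
  rcases hq3' with h | h
  · rw [h] at e6
    simp only [pow_one, inv_inv] at e6
    rw [hti, ← ht, ← hg, ← hg', ← hs] at e6
    have : t * ((m + s) * g) * (c * (t - 1)) = 0 := by linear_combination t * e5 - e6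
    have hc0 : c ≠ 0 := by intro h; rw [h] at hc; simp at hc
    have h5 : t - 1 = 0 := by
      simpa [ht0, hms, hg0, hc0] using this
    exact sub_eq_zero.1 h5
  · rw [h, hinv, hinv2, inv_inv] at e6
    rw [hti, ← ht, ← hg, ← hg'] at e6
    have hw' : 1 + 2 * w ^ 2 = -s := by rw [hs]; linear_combination 2 * hw
    rw [hw'] at e6
    have : t * ((m + s) * g) * (t - 1) = 0 := by
      linear_combination e6 + c ^ 2 * t * e5 + t * ((m + s) * g) * hc
    have h5 : t - 1 = 0 := by
      simpa [ht0, hms, hg0] using this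
    exact sub_eq_zero.1 h5

lemma cube_of_char {p : ℕ} [Fact p.Prime] {K : Type} [Field K] (χ : MulChar (ZMod p) K)
    (hχ : χ ≠ 1) (hχ3 : χ ^ 3 = 1) (a : ZMod p) (ha : a ≠ 0) (h : χ a = 1) :
    ∃ x : ZMod p, x ^ 3 = a := by
  obtain ⟨u, hu⟩ := IsCyclic.exists_generator (α := (ZMod p)ˣ)
  have hu1 : χ u ≠ 1 := by
    intro h1
    apply hχ
    ext v
    obtain ⟨j, hj⟩ := (mem_powers_iff_mem_zpowers.2 (hu v))
    simp only at hj
    rw [← hj]; simp [h1]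
  have hu3 : χ u ^ 3 = 1 := by
    rw [← MulChar.pow_apply' _ (by norm_num), hχ3, MulChar.one_apply (by simp)]
  have ho : orderOf (χ u) = 3 := orderOf_eq_prime hu3 hu1
  obtain ⟨j, hj⟩ := (mem_powers_iff_mem_zpowers.2 (hu (Units.mk0 a ha)))
  simp only at hj
  have hj' : (u : ZMod p) ^ j = a := by
    have := congrArg Units.val hj
    simpa using this
  rw [← hj', map_pow] at h
  obtain ⟨k, rfl⟩ := ho ▸ orderOf_dvd_of_pow_eq_one h
  exact ⟨u ^ k, by rw [← hj']; ring⟩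

lemma uniq_rep (p : ℕ) (hp : p.Prime) (L M A B : ℤ) (h1 : 4 * (p : ℤ) = L ^ 2 + 27 * M ^ 2)
    (h2 : 4 * (p : ℤ) = A ^ 2 + 27 * B ^ 2) : L ^ 2 = A ^ 2 ∧ M ^ 2 = B ^ 2 := by
  have hp0 : (0 : ℤ) < p := by exact_mod_cast hp.pos
  have hpp : Prime (p : ℤ) := Nat.prime_iff_prime_int.1 hp
  have main : ∀ B : ℤ, 4 * (p : ℤ) = A ^ 2 + 27 * B ^ 2 → (p : ℤ) ∣ L * B - A * M →
      M ^ 2 = B ^ 2 := by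
    rintro B h2 ⟨D, hD⟩
    have hid : (L * A + 27 * M * B) ^ 2 + 27 * (L * B - A * M) ^ 2 = 16 * (p : ℤ) ^ 2 := by
      linear_combination (-(A ^ 2 + 27 * B ^ 2)) * h1 - 4 * p * h2
    have hD0 : D = 0 := by
      by_contra hD0
      have : 1 ≤ D ^ 2 := by have := sq_pos_of_ne_zero hD0; omega
      rw [hD] at hid
      nlinarith [sq_nonneg (L * A + 27 * M * B), mul_le_mul_of_nonneg_left this (sq_nonneg (p : ℤ)), sq_pos_of_ne_zero hp0.ne']
    rw [hD0, mul_zero] at hD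
    have : 4 * (p : ℤ) * (M ^ 2 - B ^ 2) = 0 := by
      linear_combination M ^ 2 * h2 - B ^ 2 * h1 - (L * B + A * M) * hD
    have : M ^ 2 - B ^ 2 = 0 := by
      rcases mul_eq_zero.1 this with h | h
      · omega
      · exact h
    linarith
  have hd : (p : ℤ) ∣ (L * B - A * M) * (L * B + A * M) :=
    ⟨4 * (B ^ 2 - M ^ 2), by linear_combination M ^ 2 * h2 - B ^ 2 * h1⟩
  have hM : M ^ 2 = B ^ 2 := by
    rcases hpp.dvd_or_dvd hd with h | h
    · exact main B h2 h
    · have := main (-B) (by rw [h2]; ring) (by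
        rw [show L * -B - A * M = -(L * B + A * M) by ring]
        exact dvd_neg.2 h)
      rw [this]; ring
  exact ⟨by linarith, hM⟩

lemma exists_hom (q : ℕ) [Fact q.Prime] : ∃ (K : Type) (_ : Field K) (_ : CharP K q) (_ : IsAlgClosed K),
    Nonempty (integralClosure ℤ ℂ →+* K) := by
  have hq : q.Prime := Fact.out
  have hnu : ¬ IsUnit ((q : integralClosure ℤ ℂ)) := by
    intro h
    obtain ⟨x, hx⟩ := h.exists_right_inv
    have hx' : (q : ℂ) * (x : ℂ) = 1 := by
      have := congrArg (Subtype.val) hx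
      simpa using this
    have hi : IsIntegral ℤ (x : ℂ) := x.2
    have hxq : (x : ℂ) = algebraMap ℚ ℂ ((q : ℚ)⁻¹) := by
      rw [eq_ratCast]; push_cast
      exact eq_inv_of_mul_eq_one_right hx'
    rw [hxq, isIntegral_algebraMap_iff (algebraMap ℚ ℂ).injective] at hi
    obtain ⟨y, hy⟩ := IsIntegrallyClosed.isIntegral_iff.1 hi
    have hq0 : (q : ℚ) ≠ 0 := by exact_mod_cast hq.ne_zero
    have : (y * q : ℚ) = 1 := by
      have hy' : (y : ℚ) = (q : ℚ)⁻¹ := by simpa using hy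
      rw [hy', inv_mul_cancel₀ hq0]
    have h1 : y * (q : ℤ) = 1 := by exact_mod_cast this
    have := Int.eq_one_or_neg_one_of_mul_eq_one' h1
    have := hq.one_lt
    omega
  obtain ⟨P, hP, hqP⟩ := exists_max_ideal_of_mem_nonunits hnu
  let _ : Field (integralClosure ℤ ℂ ⧸ P) := Ideal.Quotient.field P
  let K := AlgebraicClosure (integralClosure ℤ ℂ ⧸ P)
  let f : integralClosure ℤ ℂ →+* K :=
    (algebraMap (integralClosure ℤ ℂ ⧸ P) K).comp (Ideal.Quotient.mk P)
  have hq0 : (q : K) = 0 := by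
    have : f (q : integralClosure ℤ ℂ) = 0 := by
      simp only [f, RingHom.comp_apply, Ideal.Quotient.eq_zero_iff_mem.2 hqP, map_zero]
    simpa using this
  have : CharP K q := (CharP.charP_iff_prime_eq_zero hq).2 hq0
  exact ⟨K, inferInstance, this, inferInstance, ⟨f⟩⟩

lemma adjoin_form {R : Type*} [CommRing R] (w : R) (hw : w ^ 2 + w + 1 = 0) (z : R)
    (hz : z ∈ Algebra.adjoin ℤ {w}) : ∃ x y : ℤ, z = x + y * w := by
  induction hz using Algebra.adjoin_induction with
  | mem x hx => exact ⟨0, 1, by simpa using hx⟩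
  | algebraMap r => exact ⟨r, 0, by simp⟩
  | add x y _ _ hx hy =>
    obtain ⟨a, b, rfl⟩ := hx
    obtain ⟨c, d, rfl⟩ := hy
    exact ⟨a + c, b + d, by push_cast; ring⟩
  | mul x y _ _ hx hy =>
    obtain ⟨a, b, rfl⟩ := hx
    obtain ⟨c, d, rfl⟩ := hy
    exact ⟨a * c - b * d, a * d + b * c - b * d, by push_cast; linear_combination b * d * hw⟩

lemma prim_three {R : Type*} [CommRing R] [IsDomain R] (w : R) (hw : IsPrimitiveRoot w 3) :
    w ^ 2 + w + 1 = 0 := by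
  have h1 : w - 1 ≠ 0 := sub_ne_zero.2 (hw.ne_one (by norm_num))
  apply mul_left_cancel₀ h1
  linear_combination hw.pow_eq_one

/-- characteristic zero computation of the Jacobi sum -/
lemma char_zero (p : ℕ) [Fact p.Prime] (hp3 : p % 3 = 1) :
    ∃ (w : integralClosure ℤ ℂ) (χ : MulChar (ZMod p) (integralClosure ℤ ℂ)) (A B : ℤ),
      w ^ 2 + w + 1 = 0 ∧ χ ≠ 1 ∧ χ ^ 3 = 1 ∧ 4 * (p : ℤ) = A ^ 2 + 27 * B ^ 2 ∧
      2 * jacobiSum χ χ = A + 3 * B * (1 + 2 * w) ∧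
      2 * jacobiSum χ⁻¹ χ⁻¹ = A - 3 * B * (1 + 2 * w) := by
  have hζ := Complex.isPrimitiveRoot_exp 3 (by norm_num)
  set ζ := Complex.exp (2 * Real.pi * Complex.I / (3 : ℕ)) with hζd
  clear_value ζ
  have hζi : ζ ∈ integralClosure ℤ ℂ := hζ.isIntegral (by norm_num)
  let w : integralClosure ℤ ℂ := ⟨ζ, hζi⟩
  have hinj : Function.Injective (integralClosure ℤ ℂ).val := Subtype.val_injective
  have hw : IsPrimitiveRoot w 3 := by
    apply IsPrimitiveRoot.of_map_of_injective (f := (integralClosure ℤ ℂ).val) _ hinj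
    exact hζ
  have hww := prim_three w hw
  have hdvd : 3 ∣ Fintype.card (ZMod p) - 1 := by rw [ZMod.card]; omega
  obtain ⟨χ, hχ⟩ := MulChar.exists_mulChar_orderOf (ZMod p) hdvd hw
  have hχ3 : χ ^ 3 = 1 := by rw [← hχ]; exact pow_orderOf_eq_one χ
  have hχ1 : χ ≠ 1 := by intro h; rw [h, orderOf_one] at hχ; norm_num at hχ
  have hχ2 : χ * χ ≠ 1 := by
    intro h
    rw [pow_succ, pow_two, h, one_mul] at hχ3
    exact hχ1 hχ3
  obtain ⟨z, hz, hJ⟩ := exists_jacobiSum_eq_neg_one_add (n := 3) (by norm_num) hχ3 hχ3 hdvd hw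
  obtain ⟨x, y, rfl⟩ := adjoin_form w hww z hz
  -- transfer to ℂ
  let ι : integralClosure ℤ ℂ →+* ℂ := (integralClosure ℤ ℂ).val.toRingHom
  have hι : Function.Injective ι := hinj
  have hιw : ι w = ζ := rfl
  have hζ2 := prim_three ζ hζ
  have hconj : (starRingEnd ℂ) ζ = ζ ^ 2 := by
    have h1 : ‖ζ‖ = 1 := hζ.norm'_eq_one (by norm_num)
    rw [← Complex.inv_eq_conj h1]
    refine inv_eq_of_mul_eq_one_right ?_
    rw [← pow_succ']; exact hζ.pow_eq_one
  have hJι : jacobiSum (χ.ringHomComp ι) (χ.ringHomComp ι) = -1 + (x + y * ζ) * (ζ - 1) ^ 2 := by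
    rw [jacobiSum_ringHomComp, hJ]
    simp [hιw]
  have hinvc : χ⁻¹.ringHomComp ι = (χ.ringHomComp ι)⁻¹ := by
    rw [eq_inv_iff_mul_eq_one, ← MulChar.ringHomComp_mul, inv_mul_cancel, MulChar.ringHomComp_one]
  have hJι' : jacobiSum (χ.ringHomComp ι)⁻¹ (χ.ringHomComp ι)⁻¹ =
      -1 + (x + y * ζ ^ 2) * (ζ ^ 2 - 1) ^ 2 := by
    have h := congrArg (starRingEnd ℂ) hJι
    simp only [map_add, map_mul, map_neg, map_one, map_pow, map_sub, map_intCast, hconj] at h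
    rw [← h, jacobiSum, jacobiSum, map_sum]
    refine Finset.sum_congr rfl fun a _ => ?_
    rw [map_mul, ← MulChar.star_apply', ← MulChar.star_apply']
    rfl
  have hprod := jacobiSum_mul_jacobiSum_inv (F := ZMod p) (F' := ℂ) (χ := χ.ringHomComp ι)
    (φ := χ.ringHomComp ι) (by
      rw [ZMod.ringChar_zmod_n, ringChar.eq_zero]; exact (Fact.out : p.Prime).ne_zero.symm)
    (by rwa [MulChar.ringHomComp_ne_one_iff hι]) (by rwa [MulChar.ringHomComp_ne_one_iff hι])
    (by rwa [← MulChar.ringHomComp_mul, MulChar.ringHomComp_ne_one_iff hι])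
  rw [hJι, hJι', ZMod.card] at hprod
  -- J = (3 y - 1) - 3 (x - y) ω
  refine ⟨w, χ, 2 * (3 * y - 1) + 3 * (x - y), -(x - y), hww, hχ1, hχ3, ?_, ?_, ?_⟩
  · have h1 : -1 + (x + y * ζ) * (ζ - 1) ^ 2 = (3 * y - 1) - 3 * (x - y) * ζ := by
      linear_combination (y * ζ + x - 3 * y) * hζ2
    have h2 : -1 + (x + y * ζ ^ 2) * (ζ ^ 2 - 1) ^ 2 = (3 * y - 1) + 3 * (x - y) * (1 + ζ) := by
      have e1 : ζ ^ 2 = -1 - ζ := by linear_combination hζ2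
      rw [e1]
      linear_combination (-y * ζ + x - 4 * y) * hζ2
    rw [h1, h2] at hprod
    have : (4 * (p : ℤ) : ℂ) = (2 * (3 * y - 1) + 3 * (x - y)) ^ 2 + 27 * (-(x - y)) ^ 2 := by
      push_cast
      rw [← hprod]
      linear_combination (-36 * (x - y) ^ 2) * hζ2
    exact_mod_cast this
  · rw [hJ]; push_cast
    linear_combination 2 * (y * w + x - 3 * y) * hww
  · apply hι
    rw [map_mul, ← jacobiSum_ringHomComp, hinvc, hJι']
    simp only [map_sub, map_add, map_mul, map_intCast, map_one, map_ofNat, hιw]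
    push_cast
    have e1 : ζ ^ 2 = -1 - ζ := by linear_combination hζ2
    rw [e1]
    linear_combination 2 * (-y * ζ + x - 4 * y) * hζ2


/-- If p ≡ 1 (mod 3) is prime, 4p = L² + 27M², and q ≠ p is a prime not dividing 6LM
such that q ∣ M(m³ - 9m) + L(m² - 1) for some integer m, then q is a cubic residue
modulo p. -/
theorem cubic_residue_of_dvd_value (p : ℕ) (hp : p.Prime) (hp3 : p % 3 = 1)
    (L M : ℤ) (hLM : 4 * (p : ℤ) = L ^ 2 + 27 * M ^ 2)
    (q : ℕ) (hq : q.Prime) (hqp : q ≠ p) (hndvd : ¬ (q : ℤ) ∣ 6 * L * M)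
    (hm : ∃ m : ℤ, (q : ℤ) ∣ M * (m ^ 3 - 9 * m) + L * (m ^ 2 - 1)) :
    ∃ x : ℤ, x ^ 3 ≡ (q : ℤ) [ZMOD (p : ℤ)] := by
  have : Fact p.Prime := ⟨hp⟩
  have : Fact q.Prime := ⟨hq⟩
  obtain ⟨m, hm⟩ := hm
  have hq2 : q ≠ 2 := by
    rintro rfl
    exact hndvd ⟨3 * L * M, by push_cast; ring⟩
  have hq3 : q ≠ 3 := by
    rintro rfl
    exact hndvd ⟨2 * L * M, by push_cast; ring⟩
  obtain ⟨w, χ, A, B, hw, hχ, hχ3, hAB, hJ, hJ'⟩ := char_zero p hp3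
  obtain ⟨hA, hB⟩ := uniq_rep p hp L M A B hLM hAB
  have hm' : ∃ m' : ℤ, (q : ℤ) ∣ B * (m' ^ 3 - 9 * m') + A * (m' ^ 2 - 1) := by
    obtain ⟨k, hk⟩ := hm
    rcases sq_eq_sq_iff_eq_or_eq_neg.1 hA with rfl | rfl <;>
    rcases sq_eq_sq_iff_eq_or_eq_neg.1 hB with rfl | rfl
    · exact ⟨m, k, hk⟩
    · exact ⟨-m, k, by linear_combination hk⟩
    · exact ⟨-m, -k, by linear_combination -hk⟩
    · exact ⟨m, -k, by linear_combination -hk⟩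
  obtain ⟨m', hm'⟩ := hm'
  obtain ⟨K, _, _, _, ⟨f⟩⟩ := exists_hom q
  have hpK : (p : K) ≠ 0 := by
    rw [Ne, CharP.cast_eq_zero_iff K q, Nat.prime_dvd_prime_iff_eq hq hp]; exact hqp
  have h3K : (3 : K) ≠ 0 := by
    have : ((3 : ℕ) : K) ≠ 0 := by
      rw [Ne, CharP.cast_eq_zero_iff K q, Nat.prime_dvd_prime_iff_eq hq Nat.prime_three]; exact hq3
    exact_mod_cast this
  have : NeZero (p : K) := ⟨hpK⟩
  obtain ⟨ζ, hζ⟩ := HasEnoughRootsOfUnity.exists_primitiveRoot K p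
  have hψ := AddChar.zmodChar_primitive_of_primitive_root p hζ
  have hinv : χ⁻¹.ringHomComp f = (χ.ringHomComp f)⁻¹ := by
    rw [eq_inv_iff_mul_eq_one, ← MulChar.ringHomComp_mul, inv_mul_cancel, MulChar.ringHomComp_one]
  have hf3 : (χ.ringHomComp f) ^ 3 = 1 := by
    rw [MulChar.ringHomComp_pow, hχ3, MulChar.ringHomComp_one]
  have hf1 : χ.ringHomComp f ≠ 1 := by
    intro h
    obtain ⟨u, hu⟩ := MulChar.ne_one_iff.1 hχ
    have hu3 : χ u ^ 3 = 1 := by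
      rw [← MulChar.pow_apply' _ (by norm_num), hχ3, MulChar.one_apply (by simp)]
    have hu2 : χ u ^ 2 + χ u + 1 = 0 := by
      apply mul_left_cancel₀ (sub_ne_zero.2 hu)
      linear_combination hu3
    have h1 : f (χ u) = 1 := by
      rw [← MulChar.ringHomComp_apply, h, MulChar.one_apply (by simp)]
    have h2 := congrArg f hu2
    simp only [map_add, map_pow, map_one, map_zero, h1] at h2
    apply h3K
    linear_combination h2
  have hf2 : f 2 = 2 := map_ofNat f 2
  have hff3 : f 3 = 3 := map_ofNat f 3
  have hχq := key_field (p := p) (q := q) hqp hq2 hq3 (χ.ringHomComp f) hf1 hf3 _ hψ (f w)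
    (by simpa using congrArg f hw) A B m'
    (by rw [jacobiSum_ringHomComp]; simpa [hf2, hff3] using congrArg f hJ)
    (by rw [← hinv, jacobiSum_ringHomComp]; simpa [hf2, hff3] using congrArg f hJ')
    (by
      have := (CharP.intCast_eq_zero_iff K q _).2 hm'
      push_cast at this
      exact this)
  have hqz : (q : ZMod p) ≠ 0 := by
    rw [Ne, CharP.cast_eq_zero_iff (ZMod p) p, Nat.prime_dvd_prime_iff_eq hp hq]; exact hqp.symm
  obtain ⟨x, hx⟩ := cube_of_char _ hf1 hf3 _ hqz hχq
  obtain ⟨y, rfl⟩ := ZMod.intCast_surjective x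
  refine ⟨y, ?_⟩
  rw [← ZMod.intCast_eq_intCast_iff]
  push_cast
  exact hx
end

section
/- For every ε with 0 < ε ≤ 1/2 there exists a bound p₀(ε) such that for every prime p ≡ 1 (mod 4) with p > p₀(ε), the number of primes q < p^{1/2+ε} that are quadratic residues modulo p exceeds p^{2ε/9}. -/
/-- An upper bound for a `q`-adic valuation by counting dividing powers. -/
theorem aux_val (q n B : ℕ) (hq : q.Prime) (hn : n ≠ 0) (hB : n ≤ B) :
    n.factorization q ≤ ∑ j ∈ Finset.Ico 1 (Nat.log q B + 1), if q ^ j ∣ n then 1 else 0 := by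
  rw [← Finset.card_filter]
  have h : Finset.Icc 1 (n.factorization q) ⊆
      (Finset.Ico 1 (Nat.log q B + 1)).filter (fun j => q ^ j ∣ n) := by
    intro j hj
    rw [Finset.mem_Icc] at hj
    have hd : q ^ j ∣ n := (hq.pow_dvd_iff_le_factorization hn).2 hj.2
    rw [Finset.mem_filter, Finset.mem_Ico]
    refine ⟨⟨hj.1, Nat.lt_succ_of_le ?_⟩, hd⟩
    exact Nat.le_log_of_pow_le hq.one_lt ((Nat.le_of_dvd (Nat.pos_of_ne_zero hn) hd).trans hB)
  have := Finset.card_le_card h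
  simpa using this

theorem aux_mod (N r v : ℕ) (hr : 0 < r) :
    ((Finset.range N).filter (fun i => i ≡ v [MOD r])).card ≤ N / r + 1 := by
  rw [← Nat.count_eq_card_filter_range, Nat.count_modEq_card _ hr]
  split_ifs <;> omega

theorem aux_count (p a N q j : ℕ) (hp : p.Prime) (hq : q.Prime) (hq2 : q ≠ 2) (hqp : q ≠ p)
    (hpa : p ≤ 4 * a ^ 2) :
    ((Finset.range N).filter (fun i => q ^ j ∣ 4 * (a + i) ^ 2 - p)).card
      ≤ 2 * (N / q ^ j + 1) := by
  have hr : 0 < q ^ j := pow_pos hq.pos j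
  rcases Finset.eq_empty_or_nonempty
    ((Finset.range N).filter (fun i => q ^ j ∣ 4 * (a + i) ^ 2 - p)) with h | ⟨i₀, h⟩
  · rw [h]; simp
  have key : ∀ i, q ^ j ∣ 4 * (a + i) ^ 2 - p →
      ((q : ℤ) ^ j ∣ 4 * ((a : ℤ) + i) ^ 2 - p) := by
    intro i hi
    have hle : p ≤ 4 * (a + i) ^ 2 := hpa.trans (by gcongr; omega)
    have := Int.natCast_dvd_natCast.2 hi
    rw [Nat.cast_sub hle] at this
    push_cast at this
    exact this
  have hi₀ := key i₀ (Finset.mem_filter.1 h).2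
  obtain ⟨w, hw⟩ : ∃ w : ℕ, (q : ℤ) ^ j ∣ (w : ℤ) + (2 * a + i₀) := by
    refine ⟨(2 * a + i₀) * (q ^ j - 1), ⟨2 * a + i₀, ?_⟩⟩
    rw [Nat.cast_mul, Nat.cast_sub hr]; push_cast; ring
  have hsub : (Finset.range N).filter (fun i => q ^ j ∣ 4 * (a + i) ^ 2 - p) ⊆
      (Finset.range N).filter (fun i => i ≡ i₀ [MOD q ^ j]) ∪
      (Finset.range N).filter (fun i => i ≡ w [MOD q ^ j]) := by
    intro i hi
    rw [Finset.mem_filter] at hi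
    have hi1 := key i hi.2
    have hqi : Prime (q : ℤ) := Nat.prime_iff_prime_int.1 hq
    have hd : (q : ℤ) ^ j ∣ 4 * (((i : ℤ) - i₀) * (2 * a + i + i₀)) := by
      have := dvd_sub hi1 hi₀
      ring_nf at this ⊢
      exact this
    have h2 : ¬ (q : ℤ) ∣ 2 := by
      intro h
      have : q ∣ 2 := by exact_mod_cast h
      exact hq2 ((Nat.prime_dvd_prime_iff_eq hq Nat.prime_two).1 this)
    have h4 : ¬ (q : ℤ) ∣ 4 := by
      intro h
      rw [show (4 : ℤ) = 2 * 2 by norm_num] at h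
      rcases hqi.dvd_or_dvd h with h | h <;> exact h2 h
    have hcop : ∀ z : ℤ, ¬ (q : ℤ) ∣ z → IsCoprime ((q : ℤ) ^ j) z := by
      intro z hz
      exact IsCoprime.pow_left ((Prime.coprime_iff_not_dvd hqi).2 hz)
    have hd2 := (hcop 4 h4).dvd_of_dvd_mul_left hd
    have hor : (q : ℤ) ^ j ∣ (i : ℤ) - i₀ ∨ (q : ℤ) ^ j ∣ 2 * (a : ℤ) + i + i₀ := by
      by_cases hj : j = 0
      · left; simp [hj]
      by_cases hA : (q : ℤ) ∣ (i : ℤ) - i₀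
      · by_cases hB : (q : ℤ) ∣ 2 * (a : ℤ) + i + i₀
        · exfalso
          have h3 : (q : ℤ) ∣ 2 * ((a : ℤ) + i) := by
            have := dvd_add hA hB
            ring_nf at this ⊢
            exact this
          have h5 : (q : ℤ) ∣ (p : ℤ) := by
            have h6 := (dvd_pow_self (q : ℤ) hj).trans hi1
            have h7 := dvd_sub (h3.mul_left (2 * ((a : ℤ) + i))) h6
            ring_nf at h7
            exact h7
          have h8 : q ∣ p := by exact_mod_cast h5
          exact hqp ((Nat.prime_dvd_prime_iff_eq hq hp).1 h8)
        · left; exact (hcop _ hB).dvd_of_dvd_mul_right hd2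
      · right; exact (hcop _ hA).dvd_of_dvd_mul_left hd2
    rw [Finset.mem_union, Finset.mem_filter, Finset.mem_filter]
    rcases hor with h | h
    · left
      refine ⟨hi.1, Nat.ModEq.symm ?_⟩
      rw [Nat.modEq_iff_dvd]; exact_mod_cast h
    · right
      refine ⟨hi.1, Nat.ModEq.symm ?_⟩
      rw [Nat.modEq_iff_dvd]
      have := dvd_sub h hw
      push_cast
      ring_nf at this ⊢
      exact this
  calc _ ≤ _ := Finset.card_le_card hsub
    _ ≤ _ := Finset.card_union_le _ _
    _ ≤ (N / q ^ j + 1) + (N / q ^ j + 1) := add_le_add (aux_mod _ _ _ hr) (aux_mod _ _ _ hr)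
    _ = _ := by ring

theorem aux_prod (p a N : ℕ) (hp : p.Prime) (hp2 : p ≠ 2) (hpa : p < 4 * a ^ 2) (hN : N ≤ p)
    (hub : ∀ i < N, 4 * (a + i) ^ 2 - p < p) :
    (∏ i ∈ Finset.range N, (4 * (a + i) ^ 2 - p)) ≤
      N.factorial ^ 2 *
        p ^ (2 * (∏ i ∈ Finset.range N, (4 * (a + i) ^ 2 - p)).primeFactors.card) := by
  set f : ℕ → ℕ := fun i => 4 * (a + i) ^ 2 - p with hf
  have hlt : ∀ i, p < 4 * (a + i) ^ 2 := fun i => hpa.trans_le (by gcongr; omega)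
  have hf0 : ∀ i, f i ≠ 0 := fun i => by have := hlt i; simp only [hf]; omega
  change ∏ i ∈ Finset.range N, f i ≤ N.factorial ^ 2 *
        p ^ (2 * (∏ i ∈ Finset.range N, f i).primeFactors.card)
  set P := ∏ i ∈ Finset.range N, f i with hP
  have hP0 : P ≠ 0 := Finset.prod_ne_zero_iff.2 fun i _ => hf0 i
  have hpodd : p % 2 = 1 := hp.eq_two_or_odd.resolve_left hp2
  have hmem : ∀ q ∈ P.primeFactors, q.Prime ∧ q ≠ 2 ∧ q ≠ p := by
    intro q hq
    have hqp := Nat.prime_of_mem_primeFactors hq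
    obtain ⟨i, hi, hd⟩ := (hqp.prime.dvd_finsetProd_iff _).1 (Nat.dvd_of_mem_primeFactors hq)
    refine ⟨hqp, ?_, ?_⟩
    · rintro rfl
      have h1 := hlt i
      simp only [hf] at hd
      omega
    · rintro rfl
      have h1 := hub i (Finset.mem_range.1 hi)
      exact absurd (Nat.le_of_dvd (Nat.pos_of_ne_zero (hf0 i)) hd) (by simp only [hf]; omega)
  have hval : ∀ q ∈ P.primeFactors,
      P.factorization q ≤ 2 * N.factorial.factorization q + 2 * Nat.log q p := by
    intro q hq
    obtain ⟨h1, h2, h3⟩ := hmem q hq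
    rw [hP, Nat.factorization_prod_apply (fun i _ => hf0 i)]
    calc ∑ i ∈ Finset.range N, (f i).factorization q
        ≤ ∑ i ∈ Finset.range N, ∑ j ∈ Finset.Ico 1 (Nat.log q p + 1),
            if q ^ j ∣ f i then 1 else 0 := by
          apply Finset.sum_le_sum
          intro i hi
          exact aux_val q (f i) p h1 (hf0 i) (hub i (Finset.mem_range.1 hi)).le
      _ = ∑ j ∈ Finset.Ico 1 (Nat.log q p + 1), ∑ i ∈ Finset.range N,
            if q ^ j ∣ f i then 1 else 0 := Finset.sum_comm
      _ ≤ ∑ j ∈ Finset.Ico 1 (Nat.log q p + 1), 2 * (N / q ^ j + 1) := by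
          apply Finset.sum_le_sum
          intro j _
          rw [← Finset.card_filter]
          exact aux_count p a N q j hp h1 h2 h3 hpa.le
      _ = _ := by
          rw [Nat.factorization_factorial h1
            (Nat.lt_succ_of_le (Nat.log_mono_right hN)), ← Finset.mul_sum,
            Finset.sum_add_distrib]
          simp
          ring
  have hfac : ∏ q ∈ P.primeFactors, q ^ N.factorial.factorization q ≤ N.factorial := by
    apply Nat.le_of_dvd (Nat.factorial_pos N)
    apply Finset.prod_dvd_of_isRelPrime
    · intro q hq r hr hne
      apply Nat.coprime_iff_isRelPrime.1
      exact Nat.coprime_pow_primes _ _ (hmem q hq).1 (hmem r hr).1 hne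
    · intro q hq
      exact Nat.ordProj_dvd _ _
  calc P = ∏ q ∈ P.primeFactors, q ^ P.factorization q :=
        (Nat.prod_factorization_pow_eq_self hP0).symm
    _ ≤ ∏ q ∈ P.primeFactors, ((q ^ N.factorial.factorization q) ^ 2 * p ^ 2) := by
        apply Finset.prod_le_prod'
        intro q hq
        have h1 := (hmem q hq).1
        calc q ^ P.factorization q
            ≤ q ^ (2 * N.factorial.factorization q + 2 * Nat.log q p) :=
              Nat.pow_le_pow_right h1.pos (hval q hq)
          _ = (q ^ N.factorial.factorization q) ^ 2 * (q ^ Nat.log q p) ^ 2 := by ring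
          _ ≤ _ := by gcongr; exact Nat.pow_log_le_self _ hp.ne_zero
    _ = (∏ q ∈ P.primeFactors, q ^ N.factorial.factorization q) ^ 2 *
          p ^ (2 * P.primeFactors.card) := by
        rw [Finset.prod_mul_distrib, Finset.prod_pow, Finset.prod_const, ← pow_mul]
    _ ≤ _ := by gcongr

theorem aux_K (p a N : ℕ) (hp : p.Prime) (hp2 : p ≠ 2) (hpa : p < 4 * a ^ 2) (hN : N ^ 6 ≤ p)
    (hub : ∀ i < N, 4 * (a + i) ^ 2 - p < p) (hlb : p ≤ (4 * a ^ 2 - p) ^ 2) :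
    N ≤ 12 * (∏ i ∈ Finset.range N, (4 * (a + i) ^ 2 - p)).primeFactors.card := by
  have hNp : N ≤ p := (Nat.le_self_pow (by norm_num) N).trans hN
  have h := aux_prod p a N hp hp2 hpa hNp hub
  set K := (∏ i ∈ Finset.range N, (4 * (a + i) ^ 2 - p)).primeFactors.card
  have h1 : p ^ N ≤ (∏ i ∈ Finset.range N, (4 * (a + i) ^ 2 - p)) ^ 2 := by
    rw [← Finset.prod_pow]
    calc p ^ N = ∏ i ∈ Finset.range N, p := by simp
      _ ≤ _ := by
        apply Finset.prod_le_prod'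
        intro i _
        refine hlb.trans ?_
        gcongr
        omega
  have h2 : N.factorial ^ 6 ≤ p ^ N := by
    calc N.factorial ^ 6 ≤ (N ^ N) ^ 6 := by gcongr; exact Nat.factorial_le_pow N
      _ = (N ^ 6) ^ N := by ring
      _ ≤ _ := by gcongr
  have h3 : p ^ (3 * N) ≤ p ^ (2 * N + 12 * K) := by
    calc p ^ (3 * N) = (p ^ N) ^ 3 := by ring
      _ ≤ ((N.factorial ^ 2 * p ^ (2 * K)) ^ 2) ^ 3 := by
        apply Nat.pow_le_pow_left
        exact h1.trans (Nat.pow_le_pow_left h 2)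
      _ = (N.factorial ^ 6) ^ 2 * p ^ (12 * K) := by ring
      _ ≤ (p ^ N) ^ 2 * p ^ (12 * K) := by gcongr
      _ = _ := by ring
  have := (Nat.pow_le_pow_iff_right hp.one_lt).1 h3
  omega

theorem aux_final (p a N : ℕ) (T : ℝ) (hp : p.Prime) (hp4 : p % 4 = 1) (hpa : p < 4 * a ^ 2)
    (hN : N ^ 6 ≤ p)
    (hub : ∀ i < N, 4 * (a + i) ^ 2 - p < p) (hlb : p ≤ (4 * a ^ 2 - p) ^ 2)
    (hT : ∀ i < N, ((4 * (a + i) ^ 2 - p : ℕ) : ℝ) < T) :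
    N ≤ 12 * Nat.card {q : ℕ | q.Prime ∧ (q : ℝ) < T ∧
          ∃ x : ℤ, x ^ 2 ≡ (q : ℤ) [ZMOD (p : ℤ)]} := by
  have hp2 : p ≠ 2 := by rintro rfl; omega
  refine (aux_K p a N hp hp2 hpa hN hub hlb).trans ?_
  gcongr
  have hfin : {q : ℕ | q.Prime ∧ (q : ℝ) < T ∧
          ∃ x : ℤ, x ^ 2 ≡ (q : ℤ) [ZMOD (p : ℤ)]}.Finite := by
    apply (Set.finite_Iic ⌊T⌋₊).subset
    rintro q ⟨_, h, _⟩
    exact Nat.le_floor h.le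
  rw [Nat.card_coe_set_eq, ← Set.ncard_coe_finset]
  apply Set.ncard_le_ncard _ hfin
  intro q hq
  have hq : q ∈ (∏ i ∈ Finset.range N, (4 * (a + i) ^ 2 - p)).primeFactors := hq
  have hqp := Nat.prime_of_mem_primeFactors hq
  obtain ⟨i, hi, hd⟩ := (hqp.prime.dvd_finsetProd_iff _).1 (Nat.dvd_of_mem_primeFactors hq)
  have hi := Finset.mem_range.1 hi
  have hlt : p < 4 * (a + i) ^ 2 := hpa.trans_le (by gcongr; omega)
  have hle := Nat.le_of_dvd (by omega) hd
  refine ⟨hqp, lt_of_le_of_lt (by exact_mod_cast hle) (hT i hi), ?_⟩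
  have hq2 : q ≠ 2 := by rintro rfl; omega
  have := Fact.mk hp
  have := Fact.mk hqp
  have hs : IsSquare (p : ZMod q) := by
    refine ⟨((2 * (a + i) : ℕ) : ZMod q), ?_⟩
    rw [← Nat.cast_mul, ZMod.natCast_eq_natCast_iff]
    rw [Nat.modEq_iff_dvd' (by nlinarith)]
    rw [show 2 * (a + i) * (2 * (a + i)) = 4 * (a + i) ^ 2 by ring]
    exact hd
  obtain ⟨x, hx⟩ := (ZMod.exists_sq_eq_prime_iff_of_mod_four_eq_one hp4 hq2).2 hs
  refine ⟨x.val, ?_⟩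
  rw [← ZMod.intCast_eq_intCast_iff]
  push_cast
  rw [ZMod.natCast_zmod_val, hx, sq]

theorem many_small_prime_quadratic_residues_one_mod_four (ε : ℝ) (hε : 0 < ε)
    (hε' : ε ≤ 1 / 2) :
    ∃ p₀ : ℕ, ∀ p : ℕ, p.Prime → p % 4 = 1 → p₀ < p →
      (p : ℝ) ^ (2 * ε / 9) <
        Nat.card {q : ℕ | q.Prime ∧ (q : ℝ) < (p : ℝ) ^ ((1 : ℝ) / 2 + ε) ∧
          ∃ x : ℤ, x ^ 2 ≡ (q : ℤ) [ZMOD (p : ℤ)]} := by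
  have ht : Filter.Tendsto (fun n : ℕ => (n : ℝ) ^ (ε / 9)) Filter.atTop Filter.atTop :=
    (tendsto_rpow_atTop (by positivity)).comp tendsto_natCast_atTop_atTop
  obtain ⟨p₀, h₀⟩ := Filter.eventually_atTop.1 (ht.eventually_gt_atTop 48)
  refine ⟨p₀, fun p hp hp4 hlt => ?_⟩
  have hbig := h₀ p hlt.le
  have hp1 : (1 : ℝ) ≤ p := by exact_mod_cast hp.one_le
  have hp0 : (0 : ℝ) < p := by linarith
  set u : ℝ := (p : ℝ) ^ (ε / 9) with hu
  have hu2 : (p : ℝ) ^ (2 * ε / 9) = u ^ 2 := by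
    rw [hu, ← Real.rpow_natCast, ← Real.rpow_mul hp0.le]; congr 1; push_cast; ring
  have hu9 : (p : ℝ) ^ ε = u ^ 9 := by
    rw [hu, ← Real.rpow_natCast, ← Real.rpow_mul hp0.le]; congr 1; push_cast; ring
  set s : ℝ := Real.sqrt p with hs
  have hss : s ^ 2 = p := Real.sq_sqrt hp0.le
  have hs0 : 0 < s := Real.sqrt_pos.2 hp0
  have hT : (p : ℝ) ^ ((1 : ℝ) / 2 + ε) = s * u ^ 9 := by
    rw [Real.rpow_add hp0, hu9, hs, Real.sqrt_eq_rpow]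
  have hu9s : u ^ 9 ≤ s := by
    rw [← hu9, hs, Real.sqrt_eq_rpow]
    exact Real.rpow_le_rpow_of_exponent_le hp1 hε'
  set N := ⌊u ^ 3⌋₊ with hNdef
  have hNle : (N : ℝ) ≤ u ^ 3 := Nat.floor_le (by positivity)
  have hNgt : u ^ 3 < N + 1 := Nat.lt_floor_add_one _
  set m := Nat.sqrt p with hm
  have hm1 : m * m ≤ p := Nat.sqrt_le p
  have hm2 : p < (m + 1) * (m + 1) := Nat.lt_succ_sqrt p
  obtain ⟨a, ha1, ha2⟩ : ∃ a, m + 3 ≤ 2 * a ∧ 2 * a ≤ m + 4 := ⟨m / 2 + 2, by omega, by omega⟩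
  have hpa : p < 4 * a ^ 2 := by nlinarith
  have hms : (m : ℝ) ≤ s := by
    rw [hs]; apply Real.le_sqrt_of_sq_le; rw [sq]; exact_mod_cast hm1
  have hu1 : 1 ≤ u ^ 3 := one_le_pow₀ (by linarith)
  have hu3 : u ^ 3 ≤ s := le_trans (pow_le_pow_right₀ (by linarith) (by norm_num)) hu9s
  have hTi : ∀ i < N, ((4 * (a + i) ^ 2 - p : ℕ) : ℝ) < s * u ^ 9 := by
    intro i hi
    have hle : p ≤ 4 * (a + i) ^ 2 := hpa.le.trans (by gcongr; omega)
    rw [Nat.cast_sub hle]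
    push_cast
    have hi' : (i : ℝ) ≤ u ^ 3 := le_trans (by exact_mod_cast hi.le) hNle
    have ha' : (2 * a : ℝ) ≤ m + 4 := by exact_mod_cast ha2
    have hx : 2 * ((a : ℝ) + i) ≤ s + 6 * u ^ 3 := by linarith
    have hx0 : 0 ≤ 2 * ((a : ℝ) + i) := by positivity
    have hsq : (2 * ((a : ℝ) + i)) ^ 2 ≤ (s + 6 * u ^ 3) ^ 2 := by gcongr
    have h48 : 48 < u ^ 6 := by
      calc (48 : ℝ) < u := hbig
        _ ≤ u ^ 6 := le_self_pow₀ (by linarith) (by norm_num)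
    calc 4 * ((a : ℝ) + i) ^ 2 - p ≤ 12 * s * u ^ 3 + 36 * u ^ 3 * u ^ 3 := by
          rw [← hss]; linarith
      _ ≤ 12 * s * u ^ 3 + 36 * s * u ^ 3 := by gcongr
      _ = 48 * (s * u ^ 3) := by ring
      _ < u ^ 6 * (s * u ^ 3) := by gcongr
      _ = _ := by ring
  have hub : ∀ i < N, 4 * (a + i) ^ 2 - p < p := by
    intro i hi
    have h := (hTi i hi).trans_le (mul_le_mul_of_nonneg_left hu9s hs0.le)
    rw [← sq, hss] at h
    exact_mod_cast h
  have hN6 : N ^ 6 ≤ p := by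
    have : (N : ℝ) ^ 6 ≤ p := by
      calc (N : ℝ) ^ 6 ≤ (u ^ 3) ^ 6 := by gcongr
        _ = (u ^ 9) ^ 2 := by ring
        _ ≤ s ^ 2 := by gcongr
        _ = p := hss
    exact_mod_cast this
  have hlb : p ≤ (4 * a ^ 2 - p) ^ 2 := by
    have h1 : m + 1 ≤ 4 * a ^ 2 - p := by
      have : m + 1 + p ≤ 4 * a ^ 2 := by nlinarith
      omega
    nlinarith
  rw [hT]
  have hfin := aux_final p a N (s * u ^ 9) hp hp4 hpa hN6 hub hlb hTi
  set C := Nat.card {q : ℕ | q.Prime ∧ (q : ℝ) < s * u ^ 9 ∧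
          ∃ x : ℤ, x ^ 2 ≡ (q : ℤ) [ZMOD (p : ℤ)]}
  have hfin' : (N : ℝ) ≤ 12 * C := by exact_mod_cast hfin
  rw [hu2]
  have : 48 * u ^ 2 < u ^ 3 := by nlinarith [sq_nonneg u]
  nlinarith
end

section
/- For all sufficiently large primes p, the number of primes q with q < p that are quadratic residues modulo p exceeds p^{1/9}. -/
open Finset in
lemma aux_prod_dvd (N y0 : ℕ) (hy : y0 < N) :
    (∏ y ∈ (range N).erase y0, (((y : ℤ) - y0).natAbs * (y + y0 + 1))) ∣ (2 * N).factorial := by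
  obtain ⟨m, rfl⟩ : ∃ m, N = y0 + 1 + m := ⟨N - (y0 + 1), by omega⟩
  rw [prod_mul_distrib]
  have h1 : ∏ y ∈ (range (y0 + 1 + m)).erase y0, ((y : ℤ) - y0).natAbs
      = y0.factorial * m.factorial := by
    have e : ∏ y ∈ (range (y0 + 1 + m)).erase y0, ((y : ℤ) - y0).natAbs
        = ∏ y ∈ range (y0 + 1 + m), (if y = y0 then 1 else ((y : ℤ) - y0).natAbs) := by
      rw [← mul_prod_erase (range (y0 + 1 + m)) _ (mem_range.2 hy)]
      rw [if_pos rfl, one_mul]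
      refine prod_congr rfl fun y hy => ?_
      rw [if_neg (mem_erase.1 hy).1]
    rw [e, prod_range_add, prod_range_succ, if_pos rfl, mul_one]
    congr 1
    · rw [← Nat.descFactorial_self y0, Nat.descFactorial_eq_prod_range]
      refine prod_congr rfl fun y hy => ?_
      have := mem_range.1 hy
      rw [if_neg (by omega)]; omega
    · rw [← prod_range_add_one_eq_factorial]
      refine prod_congr rfl fun y hy => ?_
      rw [if_neg (by omega)]; omega
  have h2 : (∏ y ∈ (range (y0 + 1 + m)).erase y0, (y + y0 + 1)) ∣
      (y0 + 1).ascFactorial (y0 + 1 + m) := by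
    rw [Nat.ascFactorial_eq_prod_range]
    have e : ∏ i ∈ range (y0 + 1 + m), (y0 + 1 + i) = ∏ y ∈ range (y0 + 1 + m), (y + y0 + 1) :=
      prod_congr rfl fun y _ => by ring
    rw [e]
    exact prod_dvd_prod_of_subset _ _ _ (erase_subset _ _)
  rw [h1]
  have h3 := Nat.factorial_mul_ascFactorial y0 (y0 + 1 + m)
  calc _ ∣ y0.factorial * m.factorial * (y0 + 1).ascFactorial (y0 + 1 + m) :=
        mul_dvd_mul_left _ h2
    _ = m.factorial * (y0 + (y0 + 1 + m)).factorial := by rw [← h3]; ring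
    _ ∣ (m + (y0 + (y0 + 1 + m))).factorial := Nat.factorial_mul_factorial_dvd_factorial_add _ _
    _ ∣ _ := Nat.factorial_dvd_factorial (by omega)

open Finset in
lemma aux_core (f : ℕ → ℕ) (N p : ℕ) (hN : 0 < N) (S : Finset ℕ)
    (hpos : ∀ y < N, 0 < f y) (hle : ∀ y < N, f y ≤ p)
    (hfac : ∀ y < N, ∀ q : ℕ, q.Prime → q ∣ f y → q ∈ S)
    (hdiff : ∀ y < N, ∀ y0 < N, ∀ d : ℕ, d ∣ f y → d ∣ f y0 →
      (d : ℤ) ∣ ((y : ℤ) - y0) * ((y : ℤ) + y0 + 1)) :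
    ∏ y ∈ range N, f y ≤ (2 * N).factorial * p ^ S.card := by
  have hP0 : ∏ y ∈ range N, f y ≠ 0 :=
    prod_ne_zero_iff.2 fun y hy => (hpos y (mem_range.1 hy)).ne'
  have hex : ∀ q : ℕ, ∃ y0 ∈ range N, ∀ y ∈ range N,
      (f y).factorization q ≤ (f y0).factorization q := fun q =>
    exists_max_image (range N) (fun y => (f y).factorization q) ⟨0, mem_range.2 hN⟩
  choose Y hY hmax using hex
  have key : ∏ y ∈ range N, f y ∣
      (2 * N).factorial * ∏ q ∈ S with q.Prime, q ^ (f (Y q)).factorization q := by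
    have hR0 : ∏ q ∈ S with q.Prime, q ^ (f (Y q)).factorization q ≠ 0 :=
      prod_ne_zero_iff.2 fun q hq => pow_ne_zero _ (mem_filter.1 hq).2.ne_zero
    rw [← Nat.factorization_prime_le_iff_dvd hP0 (mul_ne_zero (Nat.factorial_ne_zero _) hR0)]
    intro q hq
    by_cases hqS : q ∈ S
    swap
    · rw [Nat.factorization_eq_zero_of_not_dvd]
      · exact Nat.zero_le _
      · intro h
        obtain ⟨y, hy, hd⟩ := (hq.prime.dvd_finsetProd_iff _).1 h
        exact hqS (hfac y (mem_range.1 hy) q hq hd)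
    rw [← hq.pow_dvd_iff_le_factorization (mul_ne_zero (Nat.factorial_ne_zero _) hR0),
      Nat.factorization_prod fun y hy => (hpos y (mem_range.1 hy)).ne', Finsupp.finsetSum_apply,
      ← prod_pow_eq_pow_sum, ← mul_prod_erase _ _ (hY q), mul_comm]
    apply mul_dvd_mul
    · refine dvd_trans (prod_dvd_prod_of_dvd _ _ fun y hy => ?_)
        (aux_prod_dvd N (Y q) (mem_range.1 (hY q)))
      have hy' := mem_range.1 (mem_erase.1 hy).2
      have := hdiff y hy' (Y q) (mem_range.1 (hY q)) (q ^ (f y).factorization q)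
        (Nat.ordProj_dvd _ _)
        (dvd_trans (pow_dvd_pow _ (hmax q y (mem_range.2 hy'))) (Nat.ordProj_dvd _ _))
      have h2 := Int.natCast_dvd.1 this
      rw [Int.natAbs_mul] at h2
      have e : ((y : ℤ) + (Y q : ℤ) + 1).natAbs = y + Y q + 1 := by omega
      rw [e] at h2
      exact h2
    · exact dvd_prod_of_mem (fun q => q ^ (f (Y q)).factorization q)
        (mem_filter.2 ⟨hqS, hq⟩)
  have hb : ∏ q ∈ S with q.Prime, q ^ (f (Y q)).factorization q ≤ p ^ S.card := by
    have hp1 : 1 ≤ p := le_trans (hpos 0 hN) (hle 0 hN)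
    calc _ ≤ p ^ (S.filter Nat.Prime).card := by
          apply prod_le_pow_card
          intro q _
          have h := mem_range.1 (hY q)
          exact (Nat.ordProj_le _ (hpos _ h).ne').trans (hle _ h)
      _ ≤ _ := Nat.pow_le_pow_right hp1 (card_filter_le _ _)
  calc _ ≤ _ := Nat.le_of_dvd (Nat.pos_of_ne_zero ?_) key
    _ ≤ _ := Nat.mul_le_mul_left _ hb
  exact mul_ne_zero (Nat.factorial_ne_zero _)
    (prod_ne_zero_iff.2 fun q hq => pow_ne_zero _ (mem_filter.1 hq).2.ne_zero)

/-- Prime divisors of `((2y+1)^2 - p*)/4` are residues, `p ≡ 1 mod 4`. -/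
lemma aux_res1 (p q y t : ℕ) (hp : p.Prime) (hq : q.Prime) (h4 : p % 4 = 1)
    (ht : 4 * t + (2 * y + 1) ^ 2 = p) (hd : q ∣ t) : IsSquare ((q : ℕ) : ZMod p) := by
  have := Fact.mk hp
  have := Fact.mk hq
  by_cases h2 : q = 2
  · subst h2
    have := (ZMod.exists_sq_eq_two_iff (p := p) (by omega)).2 (by
      left
      obtain ⟨s, rfl⟩ := hd
      obtain ⟨r, hr⟩ : ∃ r, y * (y + 1) = 2 * r := (Nat.even_mul_succ_self y).two_dvd
      have : p = 8 * s + 8 * r + 1 := by rw [← ht]; nlinarith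
      omega)
    simpa using this
  · rw [ZMod.exists_sq_eq_prime_iff_of_mod_four_eq_one h4 h2]
    refine ⟨((2 * y + 1 : ℕ) : ZMod q), ?_⟩
    have : (t : ZMod q) = 0 := (ZMod.natCast_eq_zero_iff _ _).2 hd
    rw [← ht]; push_cast; rw [this]; ring

lemma aux_res3 (p q y t : ℕ) (hp : p.Prime) (hq : q.Prime) (h4 : p % 4 = 3) (hqp : q ≠ p)
    (ht : 4 * t = (2 * y + 1) ^ 2 + p) (hd : q ∣ t) : IsSquare ((q : ℕ) : ZMod p) := by
  have := Fact.mk hp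
  have := Fact.mk hq
  by_cases h2 : q = 2
  · subst h2
    have := (ZMod.exists_sq_eq_two_iff (p := p) (by omega)).2 (by
      right
      obtain ⟨s, rfl⟩ := hd
      obtain ⟨r, hr⟩ : ∃ r, y * (y + 1) = 2 * r := (Nat.even_mul_succ_self y).two_dvd
      have : p + 8 * r + 1 = 8 * s := by nlinarith
      omega)
    simpa using this
  · have h0 : (t : ZMod q) = 0 := (ZMod.natCast_eq_zero_iff _ _).2 hd
    have hneg : (p : ZMod q) = - (2 * (y : ZMod q) + 1) ^ 2 := by
      have := congrArg (Nat.cast (R := ZMod q)) ht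
      push_cast at this
      rw [h0] at this
      linear_combination -this
    have hp0 : (p : ZMod q) ≠ 0 := by
      rw [Ne, ZMod.natCast_eq_zero_iff, Nat.prime_dvd_prime_iff_eq hq hp]
      exact hqp
    have hodd := hq.eq_two_or_odd
    by_cases hq4 : q % 4 = 3
    · rw [ZMod.exists_sq_eq_prime_iff_of_mod_four_eq_three h4 hq4 hqp.symm]
      rintro ⟨a, ha⟩
      have ha0 : a ≠ 0 := by rintro rfl; simp at ha; exact hp0 ha
      refine (ZMod.exists_sq_eq_neg_one_iff (p := q)).1 ⟨(2 * (y : ZMod q) + 1) / a, ?_⟩ hq4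
      field_simp
      rw [ha] at hneg
      linear_combination -hneg
    · rw [← ZMod.exists_sq_eq_prime_iff_of_mod_four_eq_one (p := q) (q := p) (by omega) (by
        rintro rfl; omega)]
      obtain ⟨i, hi⟩ := (ZMod.exists_sq_eq_neg_one_iff (p := q)).2 hq4
      refine ⟨i * (2 * (y : ZMod q) + 1), ?_⟩
      rw [hneg]
      linear_combination (2 * (y : ZMod q) + 1) ^ 2 * hi

lemma aux_num (p N k : ℕ) (hN : 200 ≤ N) (h1 : N ^ 4 ≤ p) (h2 : p < (N + 1) ^ 4)
    (h : p ^ N ≤ 8 ^ N * ((2 * N).factorial * p ^ k)) : p < k ^ 9 := by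
  have hp1 : 1 < p := by
    have : 200 ^ 4 ≤ N ^ 4 := Nat.pow_le_pow_left hN 4
    omega
  have hk : N ≤ 3 * k := by
    have hf : (2 * N).factorial ≤ (2 * N) ^ (2 * N) := Nat.factorial_le_pow _
    have h3 : p ^ N ≤ (32 * N ^ 2) ^ N * p ^ k := by
      calc _ ≤ _ := h
        _ ≤ 8 ^ N * ((2 * N) ^ (2 * N) * p ^ k) := by gcongr
        _ = _ := by rw [pow_mul, ← mul_assoc, ← mul_pow]; congr 2; ring
    have h4 : (32 * N ^ 2) ^ 3 ≤ p ^ 2 := by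
      calc (32 * N ^ 2) ^ 3 = 32768 * N ^ 6 := by ring
        _ ≤ N ^ 2 * N ^ 6 := by gcongr; nlinarith
        _ = (N ^ 4) ^ 2 := by ring
        _ ≤ p ^ 2 := by gcongr
    have h5 : p ^ (3 * N) ≤ p ^ (2 * N + 3 * k) := by
      calc p ^ (3 * N) = (p ^ N) ^ 3 := by rw [← pow_mul, mul_comm]
        _ ≤ ((32 * N ^ 2) ^ N * p ^ k) ^ 3 := by gcongr
        _ = ((32 * N ^ 2) ^ 3) ^ N * p ^ (3 * k) := by
          rw [mul_pow, ← pow_mul, ← pow_mul, ← pow_mul, mul_comm N 3, mul_comm k 3]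
        _ ≤ (p ^ 2) ^ N * p ^ (3 * k) := by gcongr
        _ = _ := by rw [← pow_mul, ← pow_add]
    have := (Nat.pow_le_pow_iff_right hp1).1 h5
    omega
  have hk4 : 4 ≤ k := by omega
  calc p < (N + 1) ^ 4 := h2
    _ ≤ (4 * k) ^ 4 := by gcongr; omega
    _ = 4 ^ 4 * k ^ 4 := by ring
    _ ≤ k ^ 5 * k ^ 4 := by
      refine Nat.mul_le_mul_right _ ?_
      calc 4 ^ 4 ≤ 4 ^ 5 := by norm_num
        _ ≤ k ^ 5 := by gcongr
    _ = k ^ 9 := by ring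

/-- For all sufficiently large primes p, the number of primes q < p that are quadratic
residues modulo p exceeds p^(1/9). -/
theorem many_prime_quadratic_residues_below_p :
    ∃ p₀ : ℕ, ∀ p : ℕ, p.Prime → p₀ < p →
      (p : ℝ) ^ ((1 : ℝ) / 9) <
        Nat.card {q : ℕ | q.Prime ∧ q < p ∧
          ∃ x : ℤ, x ^ 2 ≡ (q : ℤ) [ZMOD (p : ℤ)]} := by
  refine ⟨200 ^ 4, fun p hp hp0 => ?_⟩
  set A : Set ℕ := {q : ℕ | q.Prime ∧ q < p ∧ ∃ x : ℤ, x ^ 2 ≡ (q : ℤ) [ZMOD (p : ℤ)]} with hA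
  have hfin : A.Finite := (Set.finite_lt_nat p).subset fun q hq => hq.2.1
  have hcard : Nat.card A = hfin.toFinset.card := Nat.card_eq_card_finite_toFinset hfin
  set S := hfin.toFinset with hS
  rw [hcard]
  have hmem : ∀ q : ℕ, q.Prime → q < p → IsSquare ((q : ℕ) : ZMod p) → q ∈ S := by
    intro q hq hqp hsq
    rw [hS, Set.Finite.mem_toFinset]
    refine ⟨hq, hqp, ?_⟩
    obtain ⟨a, ha⟩ := hsq
    obtain ⟨x, rfl⟩ := ZMod.intCast_surjective a
    refine ⟨x, ?_⟩
    rw [← ZMod.intCast_eq_intCast_iff]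
    push_cast
    rw [ha]; ring
  set N := Nat.sqrt (Nat.sqrt p) with hNdef
  have hN1 : N ^ 4 ≤ p := by
    have a := Nat.sqrt_le' p
    have b := Nat.sqrt_le' (Nat.sqrt p)
    calc N ^ 4 = (N ^ 2) ^ 2 := by ring
      _ ≤ (Nat.sqrt p) ^ 2 := by gcongr
      _ ≤ p := a
  have hN2 : p < (N + 1) ^ 4 := by
    have a := Nat.lt_succ_sqrt' p
    have b : Nat.sqrt p + 1 ≤ (N + 1) ^ 2 := Nat.lt_succ_sqrt' (Nat.sqrt p)
    calc p < (Nat.sqrt p + 1) ^ 2 := a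
      _ ≤ ((N + 1) ^ 2) ^ 2 := by gcongr
      _ = _ := by ring
  have hN : 200 ≤ N := by
    by_contra hc
    have : (N + 1) ^ 4 ≤ 200 ^ 4 := Nat.pow_le_pow_left (by omega) 4
    omega
  have hsmall : ∀ y < N, 16 * (y * y + y + 1) ≤ p := by
    intro y hy
    have : y * y + y + 1 ≤ N * N := by nlinarith
    have h16 : 16 ≤ N * N := by nlinarith
    calc 16 * (y * y + y + 1) ≤ (N * N) * (N * N) := Nat.mul_le_mul h16 this
      _ = N ^ 4 := by ring
      _ ≤ p := hN1
  have main : p ^ N ≤ 8 ^ N * ((2 * N).factorial * p ^ S.card) := by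
    have red : ∀ f : ℕ → ℕ, (∀ y < N, p ≤ 8 * f y) →
        ∏ y ∈ Finset.range N, f y ≤ (2 * N).factorial * p ^ S.card →
        p ^ N ≤ 8 ^ N * ((2 * N).factorial * p ^ S.card) := by
      intro f hf h
      calc p ^ N = ∏ y ∈ Finset.range N, p := by simp
        _ ≤ ∏ y ∈ Finset.range N, (8 * f y) :=
          Finset.prod_le_prod' fun y hy => hf y (Finset.mem_range.1 hy)
        _ = 8 ^ N * ∏ y ∈ Finset.range N, f y := by simp [Finset.prod_mul_distrib]
        _ ≤ _ := Nat.mul_le_mul_left _ h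
    have hodd := hp.eq_two_or_odd
    have h13 : p % 4 = 1 ∨ p % 4 = 3 := by omega
    rcases h13 with h4 | h4
    · obtain ⟨c, hc⟩ : ∃ c, p = 4 * c + 1 := ⟨p / 4, by omega⟩
      have hlow : ∀ y < N, p ≤ 8 * (c - (y * y + y)) := by
        intro y hy
        have := hsmall y hy
        omega
      refine red (fun y => c - (y * y + y)) hlow ?_
      apply aux_core _ N p (by omega)
      · intro y hy
        have := hlow y hy
        show 0 < c - (y * y + y)
        omega
      · intro y hy
        show c - (y * y + y) ≤ p
        omega
      · intro y hy q hq hd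
        have hd : q ∣ c - (y * y + y) := hd
        have hl := hlow y hy
        have hs := hsmall y hy
        have hqle := Nat.le_of_dvd (by omega) hd
        refine hmem q hq (by omega) (aux_res1 p q y _ hp hq h4 ?_ hd)
        have e : (2 * y + 1) ^ 2 = 4 * (y * y + y) + 1 := by ring
        omega
      · intro y hy z hz d hd1 hd2
        have hs := hsmall y hy
        have hs' := hsmall z hz
        have a := Int.natCast_dvd_natCast.2 hd1
        have b := Int.natCast_dvd_natCast.2 hd2
        have hab := dvd_sub b a
        rw [Nat.cast_sub (by omega), Nat.cast_sub (by omega)] at hab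
        push_cast at hab
        have e : ((y : ℤ) - z) * ((y : ℤ) + z + 1) = (c - (z * z + z)) - (c - (y * y + y)) := by ring
        rw [e]
        exact hab
    · obtain ⟨c, hc⟩ : ∃ c, p + 1 = 4 * c := ⟨(p + 1) / 4, by omega⟩
      refine red (fun y => c + (y * y + y)) (fun y _ => by show p ≤ 8 * (c + (y * y + y)); omega) ?_
      apply aux_core _ N p (by omega)
      · intro y hy
        show 0 < c + (y * y + y)
        omega
      · intro y hy
        have := hsmall y hy
        show c + (y * y + y) ≤ p
        omega
      · intro y hy q hq hd
        have hd : q ∣ c + (y * y + y) := hd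
        have hs := hsmall y hy
        have hqle := Nat.le_of_dvd (by omega) hd
        refine hmem q hq (by omega) (aux_res3 p q y _ hp hq h4 (by omega) ?_ hd)
        have e : (2 * y + 1) ^ 2 = 4 * (y * y + y) + 1 := by ring
        omega
      · intro y hy z hz d hd1 hd2
        have a := Int.natCast_dvd_natCast.2 hd1
        have b := Int.natCast_dvd_natCast.2 hd2
        have hab := dvd_sub a b
        push_cast at hab
        have e : ((y : ℤ) - z) * ((y : ℤ) + z + 1) = (c + (y * y + y)) - (c + (z * z + z)) := by ring
        rw [e]
        exact hab
  have hfinal := aux_num p N S.card hN hN1 hN2 main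
  have hr : (p : ℝ) < (S.card : ℝ) ^ (9 : ℕ) := by exact_mod_cast hfinal
  calc (p : ℝ) ^ ((1 : ℝ) / 9) < ((S.card : ℝ) ^ (9 : ℕ)) ^ ((1 : ℝ) / 9) :=
        Real.rpow_lt_rpow (Nat.cast_nonneg _) hr (by norm_num)
    _ = S.card := by
      rw [← Real.rpow_natCast, ← Real.rpow_mul (Nat.cast_nonneg _)]
      norm_num
end
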